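/- Let N ≥ 2 be even, let m, m' be integers with 0 < m < 2N and 0 < m' < 2N, let x ∈ ℤ, and let y ∈ ℤ with 2y ≥ m'. Assume the 2N×2N matrix G = (T^{2N}(i,j))_{i,j=0}^{2N−1} is invertible, and define K(m,x̃; m',ỹ) = −χ_{m>m'} T^{m−m'}(ỹ, x̃) + Σ_{i,j=0}^{2N−1} T^m(i, x̃) (G⁻¹)_{j,i} T^{2N−m'}(ỹ, j) for x̃, ỹ ∈ ℤ. Then the 2×2 matrix [[K(m,2x; m',2y), K(m,2x+1; m',2y)], [K(m,2x; m',2y+1), K(m,2x+1; m',2y+1)]] equals −χ_{m>m'}·(2πi)⁻¹ ∮_{γ01} A(z)^{m−m'} z^{y−x} dz/z + (2πi)⁻² ∮_{γ01} dz ∮_{γ1} dw · A(w)^{N−m'} F(w) A(z)^{m−N} · (z^{N/2}(z−1)^N)/(w^{N/2}(w−1)^N) · w^y · z^{−x} · (z(z−w))⁻¹, where γ01 is the positively oriented circle |z| = 3 and γ1 is the positively oriented circle |w−1| = 1/2, and χ_P = 1 if P holds, 0 otherwise. -/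

import Mathlib

open Matrix

/-- The two cuts `(-∞,-α²] ∪ [-β²,0]`, viewed as a subset of `ℂ`. -/
def cuts (α β : ℝ) : Set ℂ :=
  {z | ∃ t : ℝ, z = (t : ℂ) ∧ (t ≤ -α ^ 2 ∨ (-β ^ 2 ≤ t ∧ t ≤ 0))}

/-- The matrix symbol `A(z)` of the two-periodic Aztec diamond. -/
noncomputable def symbA (α β : ℝ) (z : ℂ) : Matrix (Fin 2) (Fin 2) ℂ :=
  (z - 1)⁻¹ • !![2 * (α : ℂ) * z, (α : ℂ) * (z + 1);
                 (β : ℂ) * z * (z + 1), 2 * (β : ℂ) * z]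

/-- The spectral projection `F(z)`, defined from a chosen branch `sq` of
`√(z(z+α²)(z+β²))`. -/
noncomputable def projF (α β : ℝ) (sq : ℂ → ℂ) (z : ℂ) : Matrix (Fin 2) (Fin 2) ℂ :=
  (2 : ℂ)⁻¹ • (1 : Matrix (Fin 2) (Fin 2) ℂ) +
    (2 * sq z)⁻¹ • !![((α : ℂ) - (β : ℂ)) * z, (α : ℂ) * (z + 1);
                      (β : ℂ) * z * (z + 1), -(((α : ℂ) - (β : ℂ)) * z)]

/-- `c(x) = α` for even `x` and `β` for odd `x`. -/
noncomputable def perCoef (α β : ℝ) (x : ℤ) : ℝ := if Even x then α else β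

/-- The transition kernel `T` of the two-periodic Aztec diamond:
`T(x,y) = 2c(x)` if `y ≤ x`, `c(x)` if `y = x+1`, `0` if `y > x+1`. -/
noncomputable def Tker (α β : ℝ) (x y : ℤ) : ℝ :=
  if y ≤ x then 2 * perCoef α β x
  else if y = x + 1 then perCoef α β x else 0

/-- Iterated transition kernel: `T^1 = T`, `T^k(x,y) = Σ_z T(x,z) T^{k-1}(z,y)`
(the sums have only finitely many nonzero terms). -/
noncomputable def Tpow (α β : ℝ) : ℕ → ℤ → ℤ → ℝ
  | 0, x, y => if x = y then 1 else 0
  | 1, x, y => Tker α β x y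
  | (k + 2), x, y => ∑' z : ℤ, Tker α β x z * Tpow α β (k + 1) z y

/-- The Gram matrix `G = (T^{2N}(i,j))_{i,j=0}^{2N-1}`. -/
noncomputable def gramT (α β : ℝ) (N : ℕ) : Matrix (Fin (2 * N)) (Fin (2 * N)) ℝ :=
  Matrix.of fun i j => Tpow α β (2 * N) ((i : ℕ) : ℤ) ((j : ℕ) : ℤ)

/-- The Eynard–Mehta correlation kernel
`K(m,x̃;m',ỹ) = -χ_{m>m'} T^{m-m'}(ỹ,x̃) + Σ_{i,j} T^m(i,x̃) (G⁻¹)_{j,i} T^{2N-m'}(ỹ,j)`. -/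
noncomputable def EMker (α β : ℝ) (N : ℕ) (m : ℕ) (xt : ℤ) (m' : ℕ) (yt : ℤ) : ℝ :=
  -(if m' < m then Tpow α β (m - m') yt xt else 0) +
    ∑ i : Fin (2 * N), ∑ j : Fin (2 * N),
      Tpow α β m ((i : ℕ) : ℤ) xt * (gramT α β N)⁻¹ j i *
        Tpow α β (2 * N - m') yt ((j : ℕ) : ℤ)

/-- Entrywise complex differentiability on `s` of a `2 × 2` matrix-valued function. -/
def EntryDiff (Φ : ℂ → Matrix (Fin 2) (Fin 2) ℂ) (s : Set ℂ) : Prop :=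
  ∀ a b, DifferentiableOn ℂ (fun z => Φ z a b) s

namespace EntryDiff

variable {Φ Ψ : ℂ → Matrix (Fin 2) (Fin 2) ℂ} {s t : Set ℂ}

lemma mono (h : EntryDiff Φ t) (hst : s ⊆ t) : EntryDiff Φ s :=
  fun a b => (h a b).mono hst

lemma congr (h : EntryDiff Φ s) (hΨ : ∀ z ∈ s, Ψ z = Φ z) : EntryDiff Ψ s :=
  fun a b => (h a b).congr fun z hz => by rw [hΨ z hz]

lemma const (C : Matrix (Fin 2) (Fin 2) ℂ) : EntryDiff (fun _ => C) s :=
  fun _ _ => differentiableOn_const _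

lemma add (h : EntryDiff Φ s) (h' : EntryDiff Ψ s) : EntryDiff (fun z => Φ z + Ψ z) s :=
  fun a b => (h a b).add (h' a b)

lemma sub (h : EntryDiff Φ s) (h' : EntryDiff Ψ s) : EntryDiff (fun z => Φ z - Ψ z) s :=
  fun a b => (h a b).sub (h' a b)

lemma mul (h : EntryDiff Φ s) (h' : EntryDiff Ψ s) : EntryDiff (fun z => Φ z * Ψ z) s := by
  intro a b
  simp only [Matrix.mul_apply, Fin.sum_univ_two]
  exact ((h a 0).mul (h' 0 b)).add ((h a 1).mul (h' 1 b))

lemma smul {f : ℂ → ℂ} (hf : DifferentiableOn ℂ f s) (h : EntryDiff Φ s) :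
    EntryDiff (fun z => f z • Φ z) s :=
  fun a b => hf.mul (h a b)

lemma pow (h : EntryDiff Φ s) (n : ℕ) : EntryDiff (fun z => Φ z ^ n) s := by
  induction n with
  | zero => simpa using const 1
  | succ n ih => simpa only [pow_succ] using ih.mul h

lemma sum {ι : Type*} {S : Finset ι} {Φ : ι → ℂ → Matrix (Fin 2) (Fin 2) ℂ}
    (h : ∀ i ∈ S, EntryDiff (Φ i) s) : EntryDiff (fun z => ∑ i ∈ S, Φ i z) s := by
  intro a b
  simp only [Matrix.sum_apply]
  exact DifferentiableOn.fun_sum fun i hi => h i hi a b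

lemma circleIntegrable {c : ℂ} {R : ℝ} (h : EntryDiff Φ (Metric.sphere c R)) (hR : 0 ≤ R)
    (a b : Fin 2) : CircleIntegrable (fun z => Φ z a b) c R :=
  (h a b).continuousOn.circleIntegrable hR

end EntryDiff

/-- The normalized contour integral `(2πi)⁻¹ ∮ Φ` of a matrix-valued function. -/
noncomputable def contourMean (c : ℂ) (R : ℝ) (Φ : ℂ → Matrix (Fin 2) (Fin 2) ℂ) :
    Matrix (Fin 2) (Fin 2) ℂ :=
  Matrix.of fun a b => (2 * (Real.pi : ℂ) * Complex.I)⁻¹ * ∮ z in C(c, R), Φ z a b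

namespace contourMean

variable {Φ Ψ : ℂ → Matrix (Fin 2) (Fin 2) ℂ} {c : ℂ} {R : ℝ}

lemma apply (a b : Fin 2) : contourMean c R Φ a b =
    (2 * (Real.pi : ℂ) * Complex.I)⁻¹ * ∮ z in C(c, R), Φ z a b := rfl

lemma congr (hR : 0 ≤ R) (h : ∀ z ∈ Metric.sphere c R, Φ z = Ψ z) :
    contourMean c R Φ = contourMean c R Ψ := by
  ext a b
  rw [apply, apply, circleIntegral.integral_congr hR fun z hz => by rw [h z hz]]

lemma add (hR : 0 ≤ R) (h : EntryDiff Φ (Metric.sphere c R))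
    (h' : EntryDiff Ψ (Metric.sphere c R)) :
    contourMean c R (fun z => Φ z + Ψ z) = contourMean c R Φ + contourMean c R Ψ := by
  ext a b
  simp only [apply, Matrix.add_apply]
  rw [circleIntegral.integral_add (h.circleIntegrable hR a b) (h'.circleIntegrable hR a b), mul_add]

lemma sub (hR : 0 ≤ R) (h : EntryDiff Φ (Metric.sphere c R))
    (h' : EntryDiff Ψ (Metric.sphere c R)) :
    contourMean c R (fun z => Φ z - Ψ z) = contourMean c R Φ - contourMean c R Ψ := by
  ext a b
  simp only [apply, Matrix.sub_apply]
  rw [circleIntegral.integral_sub (h.circleIntegrable hR a b) (h'.circleIntegrable hR a b), mul_sub]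

lemma sum {ι : Type*} {S : Finset ι} {Φ : ι → ℂ → Matrix (Fin 2) (Fin 2) ℂ} (hR : 0 ≤ R)
    (h : ∀ i ∈ S, EntryDiff (Φ i) (Metric.sphere c R)) :
    contourMean c R (fun z => ∑ i ∈ S, Φ i z) = ∑ i ∈ S, contourMean c R (Φ i) := by
  ext a b
  simp only [apply, Matrix.sum_apply]
  rw [circleIntegral.integral_fun_sum fun i hi => (h i hi).circleIntegrable hR a b, Finset.mul_sum]

lemma smul (k : ℂ) : contourMean c R (fun z => k • Φ z) = k • contourMean c R Φ := by
  ext a b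
  simp only [apply, Matrix.smul_apply, smul_eq_mul]
  rw [circleIntegral.integral_const_mul]
  ring

lemma const_mul (hR : 0 ≤ R) (h : EntryDiff Φ (Metric.sphere c R))
    (C : Matrix (Fin 2) (Fin 2) ℂ) :
    contourMean c R (fun z => C * Φ z) = C * contourMean c R Φ := by
  ext a b
  have hi : ∀ k, CircleIntegrable (fun z => C a k * Φ z k b) c R := fun k =>
    (h.circleIntegrable hR k b).const_smul
  simp only [apply, Matrix.mul_apply, Fin.sum_univ_two]
  rw [circleIntegral.integral_add (hi 0) (hi 1), circleIntegral.integral_const_mul,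
    circleIntegral.integral_const_mul]
  ring

lemma mul_const (hR : 0 ≤ R) (h : EntryDiff Φ (Metric.sphere c R))
    (C : Matrix (Fin 2) (Fin 2) ℂ) :
    contourMean c R (fun z => Φ z * C) = contourMean c R Φ * C := by
  ext a b
  have hi : ∀ k, CircleIntegrable (fun z => C k b * Φ z a k) c R := fun k =>
    (h.circleIntegrable hR a k).const_smul
  simp only [apply, Matrix.mul_apply, Fin.sum_univ_two, mul_comm _ (C _ b)]
  rw [circleIntegral.integral_add (hi 0) (hi 1), circleIntegral.integral_const_mul,
    circleIntegral.integral_const_mul]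
  ring

lemma eq_zero (hR : 0 ≤ R) (h : EntryDiff Φ (Metric.closedBall c R)) :
    contourMean c R Φ = 0 := by
  ext a b
  rw [apply, DiffContOnCl.circleIntegral_eq_zero hR
    ((h a b).diffContOnCl_ball subset_rfl), mul_zero, Matrix.zero_apply]

lemma two_pi_I_ne_zero : (2 * (Real.pi : ℂ) * Complex.I) ≠ 0 := by
  simp [Real.pi_ne_zero, Complex.I_ne_zero]

lemma sub_inv_smul (h : EntryDiff Φ (Metric.closedBall c R)) {w : ℂ}
    (hw : w ∈ Metric.ball c R) : contourMean c R (fun z => (z - w)⁻¹ • Φ z) = Φ w := by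
  ext a b
  have := DiffContOnCl.circleIntegral_sub_inv_smul ((h a b).diffContOnCl_ball subset_rfl) hw
  simp only [apply, Matrix.smul_apply, this]
  rw [smul_eq_mul, inv_mul_cancel_left₀ two_pi_I_ne_zero]

lemma entryDiff_sub_inv_smul {R : NNReal} (hR : 0 < R)
    (h : EntryDiff Φ (Metric.sphere c R)) :
    EntryDiff (fun w => contourMean c R (fun z => (z - w)⁻¹ • Φ z)) (Metric.ball c R) := by
  intro a b
  have := (hasFPowerSeriesOn_cauchy_integral (h.circleIntegrable R.2 a b) hR).differentiableOn
  rw [Metric.eball_coe] at this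
  exact this

end contourMean

/-- A Laurent polar part at `p` is seen in the same way by any two circles around `p`. -/
lemma circleIntegral_zpow_sub_mul_eq {h : ℂ → ℂ} (hh : Differentiable ℂ h) (p : ℂ) (n : ℕ)
    {c c' : ℂ} {R R' : ℝ} (hp : p ∈ Metric.ball c R) (hp' : p ∈ Metric.ball c' R') :
    (∮ z in C(c, R), ((z - p) ^ n)⁻¹ * h z) = ∮ z in C(c', R'), ((z - p) ^ n)⁻¹ * h z := by
  induction n generalizing h with
  | zero =>
    have key : ∀ (c : ℂ) (R : ℝ), p ∈ Metric.ball c R → (∮ z in C(c, R), h z) = 0 :=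
      fun c R hp => DiffContOnCl.circleIntegral_eq_zero (dist_nonneg.trans_lt hp).le
        hh.diffContOnCl
    simp [key c R hp, key c' R' hp']
  | succ n ih =>
    have hd : Differentiable ℂ (dslope h p) := by
      rw [← differentiableOn_univ, Complex.differentiableOn_dslope Filter.univ_mem]
      exact hh.differentiableOn
    have key : ∀ (c : ℂ) (R : ℝ), p ∈ Metric.ball c R →
        (∮ z in C(c, R), ((z - p) ^ (n + 1))⁻¹ * h z) =
          (if n = 0 then 2 * (Real.pi : ℂ) * Complex.I else 0) * h p +
            ∮ z in C(c, R), ((z - p) ^ n)⁻¹ * dslope h p z := by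
      intro c R hp
      have hR : 0 ≤ R := (dist_nonneg.trans_lt hp).le
      have hne : ∀ z ∈ Metric.sphere c R, z - p ≠ 0 := fun z hz h0 => by
        rw [sub_eq_zero] at h0
        subst h0
        exact absurd (Metric.mem_sphere.1 hz) (ne_of_lt (Metric.mem_ball.1 hp))
      have e : Set.EqOn (fun z => ((z - p) ^ (n + 1))⁻¹ * h z)
          (fun z => h p * ((z - p) ^ (n + 1))⁻¹ + ((z - p) ^ n)⁻¹ * dslope h p z)
          (Metric.sphere c R) := by
        intro z hz
        have h1 := sub_smul_dslope h p z
        have h0 := hne z hz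
        simp only [smul_eq_mul] at h1
        have h2 : h z = h p + (z - p) * dslope h p z := by rw [h1]; ring
        simp only [h2]
        field_simp
        ring
      have hc : ∀ k : ℕ, ContinuousOn (fun z => ((z - p) ^ k)⁻¹) (Metric.sphere c R) :=
        fun k => ContinuousOn.inv₀ (by fun_prop) fun z hz => pow_ne_zero _ (hne z hz)
      have i₁ : CircleIntegrable (fun z => h p * ((z - p) ^ (n + 1))⁻¹) c R :=
        (continuousOn_const.mul (hc _)).circleIntegrable hR
      have i₂ : CircleIntegrable (fun z => ((z - p) ^ n)⁻¹ * dslope h p z) c R :=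
        ((hc n).mul hd.continuous.continuousOn).circleIntegrable hR
      rw [circleIntegral.integral_congr hR e, circleIntegral.integral_add i₁ i₂,
        circleIntegral.integral_const_mul]
      congr 1
      rw [mul_comm]
      congr 1
      split_ifs with hn
      · subst hn
        simpa using circleIntegral.integral_sub_inv_of_mem_ball hp
      · have := circleIntegral.integral_sub_zpow_of_ne (n := -((n : ℤ) + 1))
          (by omega) c p R
        rw [← this]
        congr 1
    rw [key c R hp, key c' R' hp', ih hd]

lemma mem_sphere_zero_three_ne {z : ℂ} (hz : z ∈ Metric.sphere (0 : ℂ) 3) : z ≠ 0 ∧ z ≠ 1 := by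
  rw [mem_sphere_zero_iff_norm] at hz
  constructor <;> rintro rfl <;> norm_num at hz

lemma HasSum.int_even_add_odd' {f : ℤ → ℂ} {s t : ℂ} (he : HasSum (fun k => f (2 * k)) s)
    (ho : HasSum (fun k => f (2 * k + 1)) t) : HasSum f (s + t) := by
  have := mul_right_injective₀ (two_ne_zero' ℤ)
  replace ho := ((add_left_injective 1).comp this).hasSum_range_iff.2 ho
  refine (this.hasSum_range_iff.2 he).add_isCompl ?_ ho
  simpa [Function.comp_def] using Int.isCompl_even_odd

lemma HasSum.of_eq {ι : Type*} {f g : ι → ℂ} {s t : ℂ} (h : HasSum f s)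
    (hg : ∀ i, g i = f i) (ht : t = s) : HasSum g t := by
  rwa [ht, funext hg]

lemma hasSum_circleIntegral_zpow_le {h : ℂ → ℂ} (hh : ContinuousOn h (Metric.sphere 0 3))
    (x : ℤ) :
    HasSum (fun u : ℤ => if u ≤ x then ∮ z in C(0, 3), z ^ u * h z else 0)
      (∮ z in C(0, 3), z ^ (x + 1) * (z - 1)⁻¹ * h z) := by
  have hz : ContinuousOn (fun z : ℂ => z ^ (x + 1) * h z) (Metric.sphere 0 3) :=
    (continuousOn_id.zpow₀ _ fun z hz => Or.inl (mem_sphere_zero_three_ne hz).1).mul hh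
  have key := hasSum_two_pi_I_cauchyPowerSeries_integral (w := 1)
    (hz.circleIntegrable (by norm_num)) (by norm_num)
  have inj : Function.Injective (fun n : ℕ => x - (n : ℤ)) := fun a b hab => by
    simpa using hab
  rw [← inj.hasSum_iff]
  · refine key.of_eq (fun n => ?_) ?_
    · simp only [Function.comp_apply, sub_le_self_iff, Nat.cast_nonneg, if_true]
      refine circleIntegral.integral_congr (by norm_num) fun z hz => ?_
      have h0 := (mem_sphere_zero_three_ne hz).1
      simp only [sub_zero, smul_eq_mul]
      rw [sub_eq_add_neg, zpow_add₀ h0, zpow_add₀ h0, _root_.zpow_neg, zpow_natCast]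
      simp only [zpow_one, one_div, inv_pow]
      field_simp
    · refine circleIntegral.integral_congr (by norm_num) fun z hz => ?_
      simp only [zero_add, smul_eq_mul]
      ring
  · intro u hu
    rw [if_neg]
    intro hux
    exact hu ⟨(x - u).toNat, by simp [Int.toNat_of_nonneg (sub_nonneg.2 hux)]⟩

lemma hasSum_mul_circleIntegral_zpow {h : ℂ → ℂ} (hh : ContinuousOn h (Metric.sphere 0 3))
    (x v : ℤ) (p q : ℂ) :
    HasSum (fun u : ℤ => ((if u ≤ x then p else 0) + if u = v then q else 0) *
        ∮ z in C(0, 3), z ^ u * h z)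
      (∮ z in C(0, 3), (p * z ^ (x + 1) * (z - 1)⁻¹ + q * z ^ v) * h z) := by
  have hz : ∀ k : ℤ, ContinuousOn (fun z : ℂ => z ^ k) (Metric.sphere 0 3) := fun k =>
    continuousOn_id.zpow₀ _ fun z hz => Or.inl (mem_sphere_zero_three_ne hz).1
  have h1 := (hasSum_circleIntegral_zpow_le hh x).mul_left p
  have h2 := hasSum_ite_eq v (q * ∮ z in C(0, 3), z ^ v * h z)
  refine (h1.add h2).of_eq (fun u => ?_) ?_
  · by_cases h3 : u = v
    · subst h3
      split_ifs <;> ring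
    · split_ifs <;> ring
  · have i1 : CircleIntegrable (fun z : ℂ => p * (z ^ (x + 1) * (z - 1)⁻¹ * h z)) 0 3 := by
      refine ContinuousOn.circleIntegrable (by norm_num) (continuousOn_const.mul
        (((hz _).mul (ContinuousOn.inv₀ (by fun_prop) fun z hz => ?_)).mul hh))
      exact sub_ne_zero.2 (mem_sphere_zero_three_ne hz).2
    have i2 : CircleIntegrable (fun z : ℂ => q * (z ^ v * h z)) 0 3 :=
      ContinuousOn.circleIntegrable (by norm_num) (continuousOn_const.mul ((hz _).mul hh))
    rw [← circleIntegral.integral_const_mul, ← circleIntegral.integral_const_mul,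
      ← circleIntegral.integral_add i1 i2]
    congr 1
    ext z
    ring

lemma Tker_two_mul_add (α β : ℝ) (x : ℤ) (a c : Fin 2) :
    ∃ (p q : ℂ) (v : ℤ),
      (∀ u : ℤ, (Tker α β (2 * x + (a : ℕ)) (2 * u + (c : ℕ)) : ℂ) =
        (if u ≤ x then p else 0) + if u = v then q else 0) ∧
      ∀ z : ℂ, z ≠ 0 → z ≠ 1 →
        p * z ^ (x + 1) * (z - 1)⁻¹ + q * z ^ v = z ^ x * symbA α β z a c := by
  have hodd : ¬ Odd (2 * x) := by simp
  fin_cases a <;> fin_cases c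
  · refine ⟨2 * α, 0, 0, fun u => ?_, fun z h0 h1 => ?_⟩
    · by_cases h : u ≤ x
      · have h' : 2 * u ≤ 2 * x := by omega
        simp [Tker, perCoef, h]
      · have h' : ¬ 2 * u ≤ 2 * x := by omega
        have h'' : ¬ 2 * u = 2 * x + 1 := by omega
        simp [Tker, h, h'']
    · simp [symbA, zpow_add₀ h0]
      ring
  · refine ⟨2 * α, -α, x, fun u => ?_, fun z h0 h1 => ?_⟩
    · rcases lt_trichotomy u x with h | h | h
      · have h' : 2 * u + 1 ≤ 2 * x := by omega
        simp [Tker, perCoef, h', h.le, h.ne]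
      · subst h
        simp [Tker, perCoef]
        ring
      · have h' : ¬ 2 * u + 1 ≤ 2 * x := by omega
        simp [Tker, h', h.not_ge, h.ne']
    · have := sub_ne_zero.2 h1
      simp [symbA, zpow_add₀ h0]
      field_simp
      ring
  · refine ⟨2 * β, β, x + 1, fun u => ?_, fun z h0 h1 => ?_⟩
    · rcases lt_trichotomy u (x + 1) with h | h | h
      · have h' : 2 * u ≤ 2 * x + 1 := by omega
        have h'' : u ≤ x := by omega
        simp [Tker, perCoef, hodd, h', h'', h.ne]
      · subst h
        have h' : ¬ 2 * (x + 1) ≤ 2 * x + 1 := by omega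
        have h'' : 2 * (x + 1) = 2 * x + 1 + 1 := by omega
        simp [Tker, perCoef, h'']
      · have h' : ¬ 2 * u ≤ 2 * x + 1 := by omega
        have h'' : ¬ 2 * u = 2 * x + 1 + 1 := by omega
        have h3 : ¬ u ≤ x := by omega
        simp [Tker, h', h'', h3, h.ne']
    · have := sub_ne_zero.2 h1
      simp [symbA, zpow_add₀ h0]
      field_simp
      ring
  · refine ⟨2 * β, 0, 0, fun u => ?_, fun z h0 h1 => ?_⟩
    · by_cases h : u ≤ x
      · have h' : 2 * u ≤ 2 * x := by omega
        simp [Tker, perCoef, hodd, h]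
      · have h' : ¬ 2 * u ≤ 2 * x := by omega
        have h'' : ¬ 2 * u = 2 * x + 1 := by omega
        simp [Tker, h, h'']
    · simp [symbA, zpow_add₀ h0]
      ring

lemma Tpow_succ (α β : ℝ) (k : ℕ) (x y : ℤ) :
    Tpow α β (k + 1) x y = ∑' z : ℤ, Tker α β x z * Tpow α β k z y := by
  cases k with
  | zero =>
    rw [tsum_eq_single y fun z hz => by simp [Tpow, hz]]
    simp [Tpow]
  | succ k => rfl

lemma entryDiff_symbA (α β : ℝ) : EntryDiff (symbA α β) {z | z ≠ 0 ∧ z ≠ 1} := by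
  refine EntryDiff.smul (f := fun z => (z - 1)⁻¹) (DifferentiableOn.inv (by fun_prop)
    fun z hz => sub_ne_zero.2 hz.2) fun a b => ?_
  fin_cases a <;> fin_cases b <;> simp <;> fun_prop

lemma differentiableOn_zpow_of_ne {s : Set ℂ} (hs : ∀ z ∈ s, z ≠ 0) (k : ℤ) :
    DifferentiableOn ℂ (fun z : ℂ => z ^ k) s :=
  differentiableOn_zpow k s (Or.inl fun h => hs 0 h rfl)

/-- The block Toeplitz structure of `T ^ k`, with symbol `A ^ k`. -/
lemma Tpow_eq_contourMean (α β : ℝ) (k : ℕ) (x y : ℤ) (a b : Fin 2) :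
    (Tpow α β k (2 * x + (a : ℕ)) (2 * y + (b : ℕ)) : ℂ) =
      contourMean 0 3 (fun z => z ^ (x - y - 1) • symbA α β z ^ k) a b := by
  induction k generalizing x a with
  | zero =>
    simp only [pow_zero, contourMean.apply, Matrix.smul_apply, smul_eq_mul, Tpow]
    by_cases hxy : x = y
    · have h1 : (∮ z in C(0, 3), z ^ (x - y - 1) * (1 : Matrix (Fin 2) (Fin 2) ℂ) a b) =
          (2 * (Real.pi : ℂ) * Complex.I) * (1 : Matrix (Fin 2) (Fin 2) ℂ) a b := by
        rw [← circleIntegral.integral_sub_center_inv 0 (R := 3) (by norm_num),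
          ← smul_eq_mul (a := ∮ z in C(0, 3), (z - 0)⁻¹), ← circleIntegral.integral_smul_const]
        simp [hxy]
      rw [h1, inv_mul_cancel_left₀ contourMean.two_pi_I_ne_zero, Matrix.one_apply, hxy]
      by_cases hab : a = b
      · simp [hab]
      · have : (a : ℕ) ≠ b := fun h => hab (Fin.ext h)
        simp [hab, this]
    · have h1 : (∮ z in C(0, 3), z ^ (x - y - 1) * (1 : Matrix (Fin 2) (Fin 2) ℂ) a b) = 0 := by
        have := circleIntegral.integral_sub_zpow_of_ne (n := x - y - 1) (by omega) 0 0 3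
        simp only [sub_zero] at this
        simp_rw [← smul_eq_mul]
        rw [circleIntegral.integral_smul_const, this, zero_smul]
      have h2 : ¬ (2 * x + ((a : ℕ) : ℤ) = 2 * y + (b : ℕ)) := by omega
      simp [h1, h2]
  | succ k ih =>
    have hA : EntryDiff (fun z => z ^ (- y - 1) • symbA α β z ^ k) (Metric.sphere 0 3) :=
      EntryDiff.smul (differentiableOn_zpow_of_ne
        (fun z hz => (mem_sphere_zero_three_ne hz).1) _)
        (((entryDiff_symbA α β).mono fun z hz => mem_sphere_zero_three_ne hz).pow k)
    have hA' : EntryDiff (fun z => z ^ x • symbA α β z) (Metric.sphere 0 3) :=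
      EntryDiff.smul (differentiableOn_zpow_of_ne
        (fun z hz => (mem_sphere_zero_three_ne hz).1) _)
        ((entryDiff_symbA α β).mono fun z hz => mem_sphere_zero_three_ne hz)
    have hc : ∀ c : Fin 2, HasSum (fun u : ℤ =>
        (Tker α β (2 * x + (a : ℕ)) (2 * u + (c : ℕ)) : ℂ) *
          (Tpow α β k (2 * u + (c : ℕ)) (2 * y + (b : ℕ)) : ℂ))
        ((2 * (Real.pi : ℂ) * Complex.I)⁻¹ * ∮ z in C(0, 3),
          (z ^ x • symbA α β z) a c * (z ^ (- y - 1) • symbA α β z ^ k) c b) := by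
      intro c
      obtain ⟨p, q, v, hT, hS⟩ := Tker_two_mul_add α β x a c
      have h1 := (hasSum_mul_circleIntegral_zpow (hA c b).continuousOn x v p q).mul_left
        (2 * (Real.pi : ℂ) * Complex.I)⁻¹
      refine h1.of_eq (fun u => ?_) ?_
      · rw [hT, ih, contourMean.apply, mul_left_comm]
        congr 2
        refine circleIntegral.integral_congr (by norm_num) fun z hz => ?_
        simp only [Matrix.smul_apply, smul_eq_mul]
        rw [← mul_assoc, ← zpow_add₀ (mem_sphere_zero_three_ne hz).1]
        ring_nf
      · congr 1
        refine circleIntegral.integral_congr (by norm_num) fun z hz => ?_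
        simp only [hS z (mem_sphere_zero_three_ne hz).1 (mem_sphere_zero_three_ne hz).2,
          Matrix.smul_apply, smul_eq_mul]
    have key := HasSum.int_even_add_odd'
      (f := fun Z => (Tker α β (2 * x + (a : ℕ)) Z : ℂ) * (Tpow α β k Z (2 * y + (b : ℕ)) : ℂ))
      ((hc 0).of_eq (fun u => by simp) rfl) ((hc 1).of_eq (fun u => by simp) rfl)
    rw [Tpow_succ, Complex.ofReal_tsum]
    simp only [Complex.ofReal_mul]
    have i : ∀ c, CircleIntegrable (fun z =>
        (z ^ x • symbA α β z) a c * (z ^ (- y - 1) • symbA α β z ^ k) c b) 0 3 := fun c =>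
      ((hA' a c).mul (hA c b)).continuousOn.circleIntegrable (by norm_num)
    rw [key.tsum_eq, contourMean.apply, ← mul_add]
    congr 1
    refine Eq.trans (circleIntegral.integral_add (i 0) (i 1)).symm ?_
    refine circleIntegral.integral_congr (by norm_num) fun z hz => ?_
    simp only [Matrix.smul_apply, smul_eq_mul, pow_succ', Matrix.mul_apply, Fin.sum_univ_two]
    rw [show x - y - 1 = x + (-y - 1) by ring, zpow_add₀ (mem_sphere_zero_three_ne hz).1]
    ring

/-- The numerator `(z - 1) A(z)` of the symbol. -/
def symbNum (α β : ℝ) (z : ℂ) : Matrix (Fin 2) (Fin 2) ℂ :=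
  !![2 * (α : ℂ) * z, (α : ℂ) * (z + 1); (β : ℂ) * z * (z + 1), 2 * (β : ℂ) * z]

/-- The polynomial matrix `z⁻¹ (z - 1)² A(z)²`. -/
def symbSq (α β : ℝ) (z : ℂ) : Matrix (Fin 2) (Fin 2) ℂ :=
  !![4 * (α : ℂ) ^ 2 * z + (z + 1) ^ 2, 2 * (α : ℂ) * (α + β) * (z + 1);
     2 * (β : ℂ) * (α + β) * z * (z + 1), (z + 1) ^ 2 + 4 * (β : ℂ) ^ 2 * z]

/-- The polynomial matrix `z (z - 1)² A(z)⁻²`. -/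
def symbInvSq (α β : ℝ) (z : ℂ) : Matrix (Fin 2) (Fin 2) ℂ :=
  !![(z + 1) ^ 2 + 4 * (β : ℂ) ^ 2 * z, -(2 * (α : ℂ) * (α + β) * (z + 1));
     -(2 * (β : ℂ) * (α + β) * z * (z + 1)), 4 * (α : ℂ) ^ 2 * z + (z + 1) ^ 2]

lemma symbA_eq (α β : ℝ) (z : ℂ) : symbA α β z = (z - 1)⁻¹ • symbNum α β z := rfl

section Symbol

variable {α β : ℝ}

lemma symbNum_sq (hαβ : α * β = 1) (z : ℂ) :
    symbNum α β z ^ 2 = z • symbSq α β z := by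
  have h : (α : ℂ) * β = 1 := by exact_mod_cast hαβ
  ext a b
  fin_cases a <;> fin_cases b <;> simp [symbNum, symbSq, pow_two]
  · linear_combination z * (z + 1) ^ 2 * h
  · ring
  · ring
  · linear_combination z * (z + 1) ^ 2 * h

lemma symbSq_mul_symbInvSq (hαβ : α * β = 1) (z : ℂ) :
    symbSq α β z * symbInvSq α β z = ((z - 1) ^ 4) • (1 : Matrix (Fin 2) (Fin 2) ℂ) := by
  have h : (α : ℂ) * β = 1 := by exact_mod_cast hαβ
  have h2 : (4 * (α : ℂ) ^ 2 * z + (z + 1) ^ 2) * ((z + 1) ^ 2 + 4 * (β : ℂ) ^ 2 * z) -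
      (2 * (α : ℂ) * (α + β) * (z + 1)) * (2 * (β : ℂ) * (α + β) * z * (z + 1)) =
      (z - 1) ^ 4 := by
    linear_combination (16 * z ^ 2 * ((α : ℂ) * β + 1) - 4 * z * (z + 1) ^ 2 * ((α : ℂ) ^ 2 + β ^ 2)
      - 8 * z * (z + 1) ^ 2 * ((α : ℂ) * β + 1)) * h
  ext a b
  fin_cases a <;> fin_cases b <;> simp [symbSq, symbInvSq]
  · linear_combination h2
  · ring
  · ring
  · linear_combination h2

lemma isUnit_det_symbA (hαβ : α * β = 1) {z : ℂ} (h0 : z ≠ 0) (h1 : z ≠ 1) :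
    IsUnit (symbA α β z).det := by
  have h : (α : ℂ) * β = 1 := by exact_mod_cast hαβ
  have h1' := sub_ne_zero.2 h1
  have : (symbA α β z).det = -z := by
    have key : 2 * (α : ℂ) * z * (2 * (β : ℂ) * z) - (α : ℂ) * (z + 1) * ((β : ℂ) * z * (z + 1)) =
        -z * (z - 1) ^ 2 := by
      linear_combination (-z * (z - 1) ^ 2) * h
    rw [symbA, Matrix.det_smul, Matrix.det_fin_two_of, key, Fintype.card_fin, inv_pow, mul_comm,
      mul_assoc, mul_inv_cancel₀ (pow_ne_zero _ h1'), mul_one]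
  rw [this]
  exact (neg_ne_zero.2 h0).isUnit

lemma symbA_pow_eq (hαβ : α * β = 1) (n : ℕ) (z : ℂ) :
    symbA α β z ^ n = (((z - 1) ^ n)⁻¹ * z ^ (n / 2)) •
      (symbSq α β z ^ (n / 2) * symbNum α β z ^ (n % 2)) := by
  have h : symbNum α β z ^ n = z ^ (n / 2) • (symbSq α β z ^ (n / 2) * symbNum α β z ^ (n % 2)) := by
    conv_lhs => rw [← Nat.div_add_mod n 2, pow_add, pow_mul, symbNum_sq hαβ, smul_pow]
    rw [smul_mul_assoc]
  rw [symbA_eq, smul_pow, h, smul_smul, inv_pow]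

lemma symbInvSq_eq (hαβ : α * β = 1) {z : ℂ} (h0 : z ≠ 0) (h1 : z ≠ 1) :
    symbInvSq α β z = (z * (z - 1) ^ 2) • (symbA α β z ^ 2)⁻¹ := by
  have h1' := sub_ne_zero.2 h1
  have hu : IsUnit (symbA α β z ^ 2).det := by
    rw [Matrix.det_pow]
    exact (isUnit_det_symbA hαβ h0 h1).pow 2
  have h : symbA α β z ^ 2 * symbInvSq α β z = (z * (z - 1) ^ 2) • 1 := by
    rw [symbA_pow_eq hαβ]
    simp only [Nat.div_self two_pos, pow_one, Nat.mod_self, pow_zero, mul_one, smul_mul_assoc,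
      symbSq_mul_symbInvSq hαβ, smul_smul]
    congr 1
    field_simp
  rw [← Matrix.nonsing_inv_mul_cancel_left _ (symbInvSq α β z) hu, h, mul_smul_comm, mul_one]

lemma symbInvSq_pow_eq (hαβ : α * β = 1) {z : ℂ} (h0 : z ≠ 0) (h1 : z ≠ 1) (p : ℕ) :
    symbInvSq α β z ^ p = (z ^ p * (z - 1) ^ (2 * p)) • symbA α β z ^ (-((2 * p : ℕ) : ℤ)) := by
  rw [symbInvSq_eq hαβ h0 h1, smul_pow, Matrix.inv_pow', ← pow_mul, Matrix.zpow_neg_natCast,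
    mul_pow, ← pow_mul]

lemma symbInvSq_pow_mul (hαβ : α * β = 1) {z : ℂ} (h0 : z ≠ 0) (h1 : z ≠ 1) (p : ℕ) :
    symbInvSq α β z ^ p * symbA α β z ^ (2 * (2 * p)) = z ^ (2 * p) • symbSq α β z ^ p := by
  have h1' := sub_ne_zero.2 h1
  have e : symbA α β z ^ (-((2 * p : ℕ) : ℤ)) * symbA α β z ^ (2 * (2 * p)) =
      symbA α β z ^ (2 * p) := by
    rw [← zpow_natCast, ← zpow_natCast, ← Matrix.zpow_add (isUnit_det_symbA hαβ h0 h1)]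
    congr 1
    push_cast
    ring
  rw [symbInvSq_pow_eq hαβ h0 h1, smul_mul_assoc, e, symbA_pow_eq hαβ, smul_smul]
  have : 2 * p / 2 = p := by omega
  simp only [this, Nat.mul_mod_right, pow_zero, mul_one]
  congr 1
  field_simp
  ring

lemma entryDiff_symbNum : EntryDiff (symbNum α β) Set.univ := by
  intro a b
  fin_cases a <;> fin_cases b <;> simp [symbNum] <;> fun_prop

lemma entryDiff_symbSq : EntryDiff (symbSq α β) Set.univ := by
  intro a b
  fin_cases a <;> fin_cases b <;> simp [symbSq] <;> fun_prop

lemma entryDiff_symbInvSq : EntryDiff (symbInvSq α β) Set.univ := by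
  intro a b
  fin_cases a <;> fin_cases b <;> simp [symbInvSq] <;> fun_prop

end Symbol

open Polynomial in
lemma Polynomial.exists_eval_sub_eval_eq_sum (n : ℕ) (f : ℂ[X]) (hf : f.natDegree ≤ n) :
    ∃ q : ℕ → ℂ[X], ∀ z w : ℂ, f.eval z - f.eval w =
      (z - w) * ∑ k ∈ Finset.range n, z ^ k * (q k).eval w := by
  induction n generalizing f with
  | zero =>
    rw [Polynomial.eq_C_of_natDegree_le_zero hf]
    exact ⟨0, by simp⟩
  | succ n ih =>
    obtain ⟨q, hq⟩ := ih f.divX (by rw [Polynomial.natDegree_divX_eq_natDegree_tsub_one]; omega)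
    refine ⟨fun k => Nat.casesOn k f.divX q, fun z w => ?_⟩
    have e : ∀ t, f.eval t = f.divX.eval t * t + f.coeff 0 := fun t => by
      conv_lhs => rw [← Polynomial.divX_mul_X_add f]
      simp
    rw [Finset.sum_range_succ', e z, e w]
    simp only [pow_zero, one_mul, pow_succ']
    have := hq z w
    simp_rw [mul_assoc]
    rw [← Finset.mul_sum]
    linear_combination z * this

open Polynomial in
lemma symbInvSq_pow_eval (α β : ℝ) (p : ℕ) : ∃ f : Matrix (Fin 2) (Fin 2) ℂ[X],
    (∀ a b, (f a b).natDegree ≤ 2 * p) ∧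
      ∀ z a b, (symbInvSq α β z ^ p) a b = (f a b).eval z := by
  induction p with
  | zero =>
    refine ⟨1, fun a b => ?_, fun z a b => ?_⟩ <;> fin_cases a <;> fin_cases b <;> simp
  | succ p ih =>
    obtain ⟨f, hf, hfe⟩ := ih
    let g : Matrix (Fin 2) (Fin 2) ℂ[X] :=
      !![(X + 1) ^ 2 + 4 * C (β : ℂ) ^ 2 * X, -(2 * C (α : ℂ) * (C (α : ℂ) + C (β : ℂ)) * (X + 1));
        -(2 * C (β : ℂ) * (C (α : ℂ) + C (β : ℂ)) * X * (X + 1)),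
        4 * C (α : ℂ) ^ 2 * X + (X + 1) ^ 2]
    have hg : ∀ a b, (g a b).natDegree ≤ 2 := by
      intro a b
      fin_cases a <;> fin_cases b <;> simp [g] <;> (compute_degree; try norm_num)
    have hge : ∀ z a b, symbInvSq α β z a b = (g a b).eval z := by
      intro z a b
      fin_cases a <;> fin_cases b <;> simp [g, symbInvSq]
    refine ⟨f * g, fun a b => ?_, fun z a b => ?_⟩
    · rw [Matrix.mul_apply]
      refine Polynomial.natDegree_sum_le_of_forall_le _ _ fun i _ => ?_
      exact (Polynomial.natDegree_mul_le).trans (by linarith [hf a i, hg i b])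
    · simp only [pow_succ, Matrix.mul_apply, Fin.sum_univ_two, hfe, hge, Polynomial.eval_add,
        Polynomial.eval_mul]

lemma exists_symbInvSq_pow_sub (α β : ℝ) (p : ℕ) :
    ∃ q : ℕ → ℂ → Matrix (Fin 2) (Fin 2) ℂ, (∀ k, EntryDiff (q k) Set.univ) ∧
      ∀ z w, symbInvSq α β z ^ p - symbInvSq α β w ^ p =
        (z - w) • ∑ k ∈ Finset.range (2 * p), z ^ k • q k w := by
  obtain ⟨f, hf, hfe⟩ := symbInvSq_pow_eval α β p
  choose q hq using fun a b => Polynomial.exists_eval_sub_eval_eq_sum _ (f a b) (hf a b)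
  refine ⟨fun k w => Matrix.of fun a b => (q a b k).eval w,
    fun k a b => (q a b k).differentiable.differentiableOn, fun z w => ?_⟩
  ext a b
  simp only [Matrix.sub_apply, hfe, hq, Matrix.smul_apply, Matrix.sum_apply, smul_eq_mul,
    Matrix.of_apply]

section Spectral

variable {α β : ℝ} {sq : ℂ → ℂ}

lemma notMem_cuts {z : ℂ} (hz : 0 < z.re) : z ∉ cuts α β := by
  rintro ⟨t, rfl, h⟩
  simp only [Complex.ofReal_re] at hz
  rcases h with h | h
  · nlinarith [sq_nonneg α]
  · linarith

lemma ne_zero_of_re_pos {z : ℂ} (hz : 0 < z.re) : z ≠ 0 := by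
  rintro rfl
  simp at hz

/-- `(z - 1)` times the eigenvalue of `A(z)` on the range of `F(z)`. -/
def eigNum (α β : ℝ) (sq : ℂ → ℂ) (z : ℂ) : ℂ := ((α : ℂ) + β) * z + sq z

lemma eigNum_mul (hαβ : α * β = 1)
    (hsq_sq : ∀ z ∉ cuts α β, (sq z) ^ 2 = z * (z + (α : ℂ) ^ 2) * (z + (β : ℂ) ^ 2))
    {z : ℂ} (hz : 0 < z.re) :
    (((α : ℂ) + β) * z - sq z) * eigNum α β sq z = -(z * (z - 1) ^ 2) := by
  have h : (α : ℂ) * β = 1 := by exact_mod_cast hαβ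
  have h2 := hsq_sq z (notMem_cuts hz)
  rw [eigNum]
  linear_combination -h2 + (2 * z ^ 2 - z * (α * β + 1)) * h

lemma eigNum_ne_zero (hα : 1 < α) (hαβ : α * β = 1)
    (hsq_sq : ∀ z ∉ cuts α β, (sq z) ^ 2 = z * (z + (α : ℂ) ^ 2) * (z + (β : ℂ) ^ 2))
    (hsq_pos : ∀ x : ℝ, 0 < x → 0 < (sq (x : ℂ)).re ∧ (sq (x : ℂ)).im = 0)
    {z : ℂ} (hz : 0 < z.re) : eigNum α β sq z ≠ 0 := by
  by_cases h1 : z = 1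
  · subst h1
    have hβ : 0 < β := pos_of_mul_pos_right (hαβ ▸ one_pos) (by linarith)
    have := (hsq_pos 1 one_pos).1
    rw [Complex.ofReal_one] at this
    intro h0
    have h2 := congrArg Complex.re h0
    simp [eigNum] at h2
    linarith
  · intro h0
    have := eigNum_mul hαβ hsq_sq hz
    rw [h0, mul_zero] at this
    simp [sub_eq_zero, h1, ne_zero_of_re_pos hz] at this

lemma sq_ne_zero_of_re_pos
    (hsq_sq : ∀ z ∉ cuts α β, (sq z) ^ 2 = z * (z + (α : ℂ) ^ 2) * (z + (β : ℂ) ^ 2))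
    {z : ℂ} (hz : 0 < z.re) : sq z ≠ 0 := by
  intro h0
  have h2 := hsq_sq z (notMem_cuts hz)
  have key : ∀ t : ℝ, z + (t : ℂ) ^ 2 ≠ 0 := fun t h => by
    have h' := congrArg Complex.re h
    rw [← Complex.ofReal_pow, Complex.add_re, Complex.ofReal_re, Complex.zero_re] at h'
    linarith [sq_nonneg t]
  rw [h0] at h2
  simp [key, ne_zero_of_re_pos hz] at h2

/-- The traceless part of `(z - 1) A(z)`, which squares to `z(z+α²)(z+β²)`. -/
def symbDev (α β : ℝ) (z : ℂ) : Matrix (Fin 2) (Fin 2) ℂ :=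
  !![((α : ℂ) - (β : ℂ)) * z, (α : ℂ) * (z + 1);
     (β : ℂ) * z * (z + 1), -(((α : ℂ) - (β : ℂ)) * z)]

lemma projF_eq (z : ℂ) : projF α β sq z = (2 : ℂ)⁻¹ • 1 + (2 * sq z)⁻¹ • symbDev α β z := rfl

lemma symbA_eq_add_symbDev (z : ℂ) :
    symbA α β z = (z - 1)⁻¹ • ((((α : ℂ) + β) * z) • 1 + symbDev α β z) := by
  rw [symbA]
  congr 1
  ext a b
  fin_cases a <;> fin_cases b <;> simp [symbDev] <;> ring

lemma symbDev_mul_self (hαβ : α * β = 1)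
    (hsq_sq : ∀ z ∉ cuts α β, (sq z) ^ 2 = z * (z + (α : ℂ) ^ 2) * (z + (β : ℂ) ^ 2))
    {z : ℂ} (hz : 0 < z.re) :
    symbDev α β z * symbDev α β z = (sq z) ^ 2 • 1 := by
  have h : (α : ℂ) * β = 1 := by exact_mod_cast hαβ
  rw [hsq_sq z (notMem_cuts hz)]
  ext a b
  fin_cases a <;> fin_cases b <;> simp [symbDev]
  · linear_combination z * (z ^ 2 - α * β) * h
  · ring
  · ring
  · linear_combination z * (z ^ 2 - α * β) * h

lemma symbDev_mul_projF (hαβ : α * β = 1)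
    (hsq_sq : ∀ z ∉ cuts α β, (sq z) ^ 2 = z * (z + (α : ℂ) ^ 2) * (z + (β : ℂ) ^ 2))
    {z : ℂ} (hz : 0 < z.re) :
    symbDev α β z * projF α β sq z = sq z • projF α β sq z := by
  have h3 := sq_ne_zero_of_re_pos hsq_sq hz
  rw [projF_eq, mul_add, mul_smul_comm, mul_smul_comm, symbDev_mul_self hαβ hsq_sq hz, mul_one,
    smul_add, smul_smul, smul_smul, smul_smul, add_comm]
  congr 2
  · field_simp
  · field_simp

lemma symbA_mul_projF (hαβ : α * β = 1)
    (hsq_sq : ∀ z ∉ cuts α β, (sq z) ^ 2 = z * (z + (α : ℂ) ^ 2) * (z + (β : ℂ) ^ 2))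
    {z : ℂ} (hz : 0 < z.re) :
    symbA α β z * projF α β sq z = ((z - 1)⁻¹ * eigNum α β sq z) • projF α β sq z := by
  rw [symbA_eq_add_symbDev, smul_mul_assoc, add_mul, smul_mul_assoc, one_mul,
    symbDev_mul_projF hαβ hsq_sq hz, ← add_smul, smul_smul, eigNum]

lemma projF_mul_symbA (z : ℂ) :
    projF α β sq z * symbA α β z = symbA α β z * projF α β sq z := by
  rw [projF_eq, symbA_eq_add_symbDev]
  simp only [mul_add, add_mul, smul_mul_assoc, mul_smul_comm, one_mul, mul_one, smul_add]
  module

lemma symbA_mul_one_sub_projF (hα : 1 < α) (hαβ : α * β = 1)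
    (hsq_sq : ∀ z ∉ cuts α β, (sq z) ^ 2 = z * (z + (α : ℂ) ^ 2) * (z + (β : ℂ) ^ 2))
    (hsq_pos : ∀ x : ℝ, 0 < x → 0 < (sq (x : ℂ)).re ∧ (sq (x : ℂ)).im = 0)
    {z : ℂ} (hz : 0 < z.re) (h1 : z ≠ 1) :
    symbA α β z * (1 - projF α β sq z) =
      (-(z * (z - 1)) * (eigNum α β sq z)⁻¹) • (1 - projF α β sq z) := by
  have h4 := sub_ne_zero.2 h1
  have e : -(z * (z - 1)) * (eigNum α β sq z)⁻¹ = (z - 1)⁻¹ * (((α : ℂ) + β) * z - sq z) := by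
    have h5 := eigNum_ne_zero hα hαβ hsq_sq hsq_pos hz
    field_simp
    linear_combination -eigNum_mul hαβ hsq_sq hz
  have hX : symbDev α β z * (1 - projF α β sq z) = -sq z • (1 - projF α β sq z) := by
    have h3 := sq_ne_zero_of_re_pos hsq_sq hz
    have : symbDev α β z = (2 * sq z) • projF α β sq z - sq z • 1 := by
      rw [projF_eq, smul_add, smul_smul, smul_smul, mul_inv_cancel₀ (by simpa using h3), one_smul]
      rw [mul_comm 2, mul_inv_cancel_right₀ two_ne_zero]
      abel
    rw [mul_sub, symbDev_mul_projF hαβ hsq_sq hz, mul_one, this]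
    module
  rw [e, symbA_eq_add_symbDev, smul_mul_assoc, add_mul, smul_mul_assoc, one_mul, hX, ← add_smul,
    smul_smul, ← sub_eq_add_neg]

lemma Matrix.pow_mul_of_mul_eq_smul {A F : Matrix (Fin 2) (Fin 2) ℂ} {l : ℂ} (h : A * F = l • F)
    (n : ℕ) : A ^ n * F = l ^ n • F := by
  induction n with
  | zero => simp
  | succ n ih => rw [pow_succ, mul_assoc, h, mul_smul_comm, ih, smul_smul, pow_succ']

lemma Matrix.zpow_mul_of_mul_eq_smul {A F : Matrix (Fin 2) (Fin 2) ℂ} {l : ℂ} (h : A * F = l • F)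
    (hA : IsUnit A.det) (hl : l ≠ 0) (n : ℤ) : A ^ n * F = l ^ n • F := by
  obtain ⟨k, rfl | rfl⟩ := n.eq_nat_or_neg
  · simpa using Matrix.pow_mul_of_mul_eq_smul h k
  · have hk : IsUnit (A ^ k).det := by
      rw [Matrix.det_pow]
      exact hA.pow k
    have e := Matrix.pow_mul_of_mul_eq_smul h k
    rw [Matrix.zpow_neg_natCast, _root_.zpow_neg, zpow_natCast]
    have : F = (l ^ k)⁻¹ • (A ^ k * F) := by
      rw [e, smul_smul, inv_mul_cancel₀ (pow_ne_zero _ hl), one_smul]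
    conv_lhs => rw [this]
    rw [mul_smul_comm, Matrix.nonsing_inv_mul_cancel_left _ _ hk]

lemma differentiableOn_sq (hsq_an : DifferentiableOn ℂ sq (cuts α β)ᶜ) :
    DifferentiableOn ℂ sq {z | 0 < z.re} :=
  hsq_an.mono fun _ hz => notMem_cuts hz

lemma differentiableOn_eigNum (hsq_an : DifferentiableOn ℂ sq (cuts α β)ᶜ) :
    DifferentiableOn ℂ (eigNum α β sq) {z | 0 < z.re} := by
  have := differentiableOn_sq hsq_an
  unfold eigNum
  fun_prop

lemma entryDiff_projF
    (hsq_sq : ∀ z ∉ cuts α β, (sq z) ^ 2 = z * (z + (α : ℂ) ^ 2) * (z + (β : ℂ) ^ 2))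
    (hsq_an : DifferentiableOn ℂ sq (cuts α β)ᶜ) :
    EntryDiff (projF α β sq) {z | 0 < z.re} := by
  refine (EntryDiff.const _).add (EntryDiff.smul (f := fun z => (2 * sq z)⁻¹)
    (((differentiableOn_sq hsq_an).const_mul 2).inv fun z hz =>
      mul_ne_zero two_ne_zero (sq_ne_zero_of_re_pos hsq_sq hz)) fun a b => ?_)
  fin_cases a <;> fin_cases b <;> simp <;> fun_prop

end Spectral

section Contours

lemma re_pos_of_mem_closedBall {w : ℂ} (hw : w ∈ Metric.closedBall (1 : ℂ) (1 / 2)) :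
    0 < w.re := by
  have h := (Complex.abs_re_le_norm (w - 1)).trans (mem_closedBall_iff_norm.1 hw)
  rw [Complex.sub_re, Complex.one_re, abs_le] at h
  linarith [h.1]

lemma mem_ball_zero_three {w : ℂ} (hw : w ∈ Metric.closedBall (1 : ℂ) (1 / 2)) :
    w ∈ Metric.ball (0 : ℂ) 3 := by
  rw [mem_ball_zero_iff]
  have h := mem_closedBall_iff_norm.1 hw
  calc ‖w‖ = ‖(w - 1) + 1‖ := by ring_nf
    _ ≤ ‖w - 1‖ + ‖(1 : ℂ)‖ := norm_add_le _ _
    _ < 3 := by rw [norm_one]; linarith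

lemma ne_one_of_mem_sphere_one {w : ℂ} (hw : w ∈ Metric.sphere (1 : ℂ) (1 / 2)) : w ≠ 1 := by
  rintro rfl
  simp at hw

lemma sub_ne_zero_of_mem_spheres {z w : ℂ} (hz : z ∈ Metric.sphere (0 : ℂ) 3)
    (hw : w ∈ Metric.closedBall (1 : ℂ) (1 / 2)) : z - w ≠ 0 := by
  intro h
  rw [sub_eq_zero] at h
  subst h
  exact (Metric.mem_ball.1 (mem_ball_zero_three hw)).ne (Metric.mem_sphere.1 hz)

lemma entryDiff_zpow_smul_symbA_pow (α β : ℝ) (e : ℤ) (n : ℕ) :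
    EntryDiff (fun z => z ^ e • symbA α β z ^ n) {z | z ≠ 0 ∧ z ≠ 1} :=
  EntryDiff.smul (f := fun z => z ^ e) (differentiableOn_zpow_of_ne (fun _ h => h.1) e)
    ((entryDiff_symbA α β).pow n)

lemma contourMean_zpow_smul_symbA_pow {α β : ℝ} (hαβ : α * β = 1) (e : ℤ) (n : ℕ)
    (he : 0 ≤ e + (n / 2 : ℕ)) :
    contourMean 1 (1 / 2) (fun w => w ^ e • symbA α β w ^ n) =
      contourMean 0 3 (fun w => w ^ e • symbA α β w ^ n) := by
  obtain ⟨k, hk⟩ := Int.eq_ofNat_of_zero_le he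
  let Φ : ℂ → Matrix (Fin 2) (Fin 2) ℂ := fun w =>
    w ^ k • (symbSq α β w ^ (n / 2) * symbNum α β w ^ (n % 2))
  have hΦ : EntryDiff Φ Set.univ :=
    EntryDiff.smul (f := fun w => w ^ k) (by fun_prop)
      ((entryDiff_symbSq.pow _).mul (entryDiff_symbNum.pow _))
  have h : ∀ w : ℂ, w ≠ 0 → w ^ e • symbA α β w ^ n = ((w - 1) ^ n)⁻¹ • Φ w := by
    intro w hw
    rw [symbA_pow_eq hαβ, smul_smul, smul_smul]
    congr 1
    rw [← zpow_natCast w k, ← show e + (n / 2 : ℕ) = (k : ℤ) from hk, zpow_add₀ hw, zpow_natCast]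
    ring
  rw [contourMean.congr (by norm_num) fun w hw =>
      h w (ne_zero_of_re_pos (re_pos_of_mem_closedBall (Metric.sphere_subset_closedBall hw))),
    contourMean.congr (c := 0) (by norm_num) fun w hw => h w (mem_sphere_zero_three_ne hw).1]
  ext a b
  simp only [contourMean.apply, Matrix.smul_apply, smul_eq_mul]
  rw [circleIntegral_zpow_sub_mul_eq (differentiableOn_univ.1 (hΦ a b)) 1 n
    (c := 1) (R := 1 / 2) (c' := 0) (R' := 3) (by simp) (by simp)]

end Contours

/-- The `2 × 2` blocks of the iterated transition kernel. -/
noncomputable def TpowBlock (α β : ℝ) (k : ℕ) (u v : ℤ) : Matrix (Fin 2) (Fin 2) ℂ :=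
  Matrix.of fun a b => (Tpow α β k (2 * u + (a : ℕ)) (2 * v + (b : ℕ)) : ℂ)

lemma TpowBlock_eq_contourMean (α β : ℝ) (k : ℕ) (u v : ℤ) :
    TpowBlock α β k u v = contourMean 0 3 (fun z => z ^ (u - v - 1) • symbA α β z ^ k) := by
  ext a b
  exact Tpow_eq_contourMean α β k u v a b

/-- The `w`-dependent factor of the double contour integrand. -/
noncomputable def innerFactor (α β : ℝ) (sq : ℂ → ℂ) (p m' : ℕ) (y : ℤ) (w : ℂ) :
    Matrix (Fin 2) (Fin 2) ℂ :=
  (w ^ y * (w ^ p * (w - 1) ^ (2 * p))⁻¹) •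
    (symbA α β w ^ (((2 * p : ℕ) : ℤ) - m') * projF α β sq w)

section InnerFactor

variable {α β : ℝ} {sq : ℂ → ℂ}

lemma symbA_zpow_mul_projF (hα : 1 < α) (hαβ : α * β = 1)
    (hsq_sq : ∀ z ∉ cuts α β, (sq z) ^ 2 = z * (z + (α : ℂ) ^ 2) * (z + (β : ℂ) ^ 2))
    (hsq_pos : ∀ x : ℝ, 0 < x → 0 < (sq (x : ℂ)).re ∧ (sq (x : ℂ)).im = 0)
    {w : ℂ} (hw : 0 < w.re) (h1 : w ≠ 1) (n : ℤ) :
    symbA α β w ^ n * projF α β sq w = ((w - 1)⁻¹ * eigNum α β sq w) ^ n • projF α β sq w :=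
  Matrix.zpow_mul_of_mul_eq_smul (symbA_mul_projF hαβ hsq_sq hw)
    (isUnit_det_symbA hαβ (ne_zero_of_re_pos hw) h1)
    (mul_ne_zero (inv_ne_zero (sub_ne_zero.2 h1)) (eigNum_ne_zero hα hαβ hsq_sq hsq_pos hw)) n

lemma entryDiff_innerFactor (hα : 1 < α) (hαβ : α * β = 1)
    (hsq_sq : ∀ z ∉ cuts α β, (sq z) ^ 2 = z * (z + (α : ℂ) ^ 2) * (z + (β : ℂ) ^ 2))
    (hsq_an : DifferentiableOn ℂ sq (cuts α β)ᶜ)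
    (hsq_pos : ∀ x : ℝ, 0 < x → 0 < (sq (x : ℂ)).re ∧ (sq (x : ℂ)).im = 0)
    (p m' : ℕ) (y : ℤ) :
    EntryDiff (innerFactor α β sq p m' y) {w | 0 < w.re ∧ w ≠ 1} := by
  have h0 : ∀ w ∈ {w : ℂ | 0 < w.re ∧ w ≠ 1}, w ≠ 0 := fun w hw => ne_zero_of_re_pos hw.1
  have h1 : ∀ w ∈ {w : ℂ | 0 < w.re ∧ w ≠ 1}, w - 1 ≠ 0 := fun w hw => sub_ne_zero.2 hw.2
  refine EntryDiff.congr (Φ := fun w => (w ^ y * (w ^ p * (w - 1) ^ (2 * p))⁻¹ *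
    ((w - 1)⁻¹ * eigNum α β sq w) ^ (((2 * p : ℕ) : ℤ) - m')) • projF α β sq w)
    (EntryDiff.smul (f := fun w => w ^ y * (w ^ p * (w - 1) ^ (2 * p))⁻¹ *
      ((w - 1)⁻¹ * eigNum α β sq w) ^ (((2 * p : ℕ) : ℤ) - m')) ?_
      ((entryDiff_projF hsq_sq hsq_an).mono fun w hw => hw.1)) fun w hw => ?_
  · refine ((differentiableOn_zpow_of_ne h0 y).mul (DifferentiableOn.inv (by fun_prop)
      fun w hw => mul_ne_zero (pow_ne_zero _ (h0 w hw)) (pow_ne_zero _ (h1 w hw)))).mul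
      (DifferentiableOn.zpow ?_ (Or.inl fun w hw => mul_ne_zero (inv_ne_zero (h1 w hw))
        (eigNum_ne_zero hα hαβ hsq_sq hsq_pos hw.1)))
    exact (DifferentiableOn.inv (by fun_prop) h1).mul
      ((differentiableOn_eigNum hsq_an).mono fun w hw => hw.1)
  · rw [innerFactor, symbA_zpow_mul_projF hα hαβ hsq_sq hsq_pos hw.1 hw.2, smul_smul]

lemma innerFactor_mul_symbInvSq_pow (hαβ : α * β = 1) (p m' : ℕ) (y : ℤ)
    {w : ℂ} (hw : 0 < w.re) (h1 : w ≠ 1) :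
    innerFactor α β sq p m' y w * symbInvSq α β w ^ p =
      w ^ y • (symbA α β w ^ (-(m' : ℤ)) * projF α β sq w) := by
  have h0 := ne_zero_of_re_pos hw
  have h1' := sub_ne_zero.2 h1
  have hu := isUnit_det_symbA hαβ h0 h1
  have hc : ∀ n : ℤ, projF α β sq w * symbA α β w ^ n = symbA α β w ^ n * projF α β sq w :=
    fun n => (Matrix.Commute.zpow_right (projF_mul_symbA w) n).eq
  have e : w ^ y * (w ^ p * (w - 1) ^ (2 * p))⁻¹ * (w ^ p * (w - 1) ^ (2 * p)) = w ^ y :=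
    inv_mul_cancel_right₀ (mul_ne_zero (pow_ne_zero _ h0) (pow_ne_zero _ h1')) _
  rw [innerFactor, symbInvSq_pow_eq hαβ h0 h1, smul_mul_smul_comm, e, mul_assoc, hc, ← mul_assoc,
    ← Matrix.zpow_add hu]
  congr 3
  ring

lemma entryDiff_smul_projF (hα : 1 < α) (hαβ : α * β = 1)
    (hsq_sq : ∀ z ∉ cuts α β, (sq z) ^ 2 = z * (z + (α : ℂ) ^ 2) * (z + (β : ℂ) ^ 2))
    (hsq_an : DifferentiableOn ℂ sq (cuts α β)ᶜ)
    (hsq_pos : ∀ x : ℝ, 0 < x → 0 < (sq (x : ℂ)).re ∧ (sq (x : ℂ)).im = 0)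
    (m' : ℕ) (y : ℤ) :
    EntryDiff (fun w => (w ^ y * ((w - 1) * (eigNum α β sq w)⁻¹) ^ m') • projF α β sq w)
      {w | 0 < w.re} := by
  have := (differentiableOn_eigNum hsq_an).inv fun w hw =>
    eigNum_ne_zero hα hαβ hsq_sq hsq_pos hw
  refine EntryDiff.smul (f := fun w => w ^ y * ((w - 1) * (eigNum α β sq w)⁻¹) ^ m')
    ((differentiableOn_zpow_of_ne (fun w hw => ne_zero_of_re_pos hw) y).mul
      (DifferentiableOn.pow (DifferentiableOn.mul (by fun_prop) this) _))
    (entryDiff_projF hsq_sq hsq_an)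

end InnerFactor

section InnerIntegral

variable {α β : ℝ} {sq : ℂ → ℂ}

lemma innerFactor_mul_symbInvSq_pow_eq_smul_projF (hα : 1 < α) (hαβ : α * β = 1)
    (hsq_sq : ∀ z ∉ cuts α β, (sq z) ^ 2 = z * (z + (α : ℂ) ^ 2) * (z + (β : ℂ) ^ 2))
    (hsq_pos : ∀ x : ℝ, 0 < x → 0 < (sq (x : ℂ)).re ∧ (sq (x : ℂ)).im = 0)
    (p m' : ℕ) (y : ℤ) {w : ℂ} (hw : 0 < w.re) (h1 : w ≠ 1) :
    innerFactor α β sq p m' y w * symbInvSq α β w ^ p =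
      (w ^ y * ((w - 1) * (eigNum α β sq w)⁻¹) ^ m') • projF α β sq w := by
  rw [innerFactor_mul_symbInvSq_pow hαβ p m' y hw h1,
    symbA_zpow_mul_projF hα hαβ hsq_sq hsq_pos hw h1, smul_smul, _root_.zpow_neg, zpow_natCast,
    ← inv_pow, mul_inv, inv_inv]

lemma contourMean_innerFactor_mul_eq_zero (hα : 1 < α) (hαβ : α * β = 1)
    (hsq_sq : ∀ z ∉ cuts α β, (sq z) ^ 2 = z * (z + (α : ℂ) ^ 2) * (z + (β : ℂ) ^ 2))
    (hsq_an : DifferentiableOn ℂ sq (cuts α β)ᶜ)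
    (hsq_pos : ∀ x : ℝ, 0 < x → 0 < (sq (x : ℂ)).re ∧ (sq (x : ℂ)).im = 0)
    (p m' : ℕ) (y : ℤ) {Φ : ℂ → Matrix (Fin 2) (Fin 2) ℂ}
    (hΦ : EntryDiff Φ (Metric.closedBall 1 (1 / 2))) :
    contourMean 1 (1 / 2)
      (fun w => innerFactor α β sq p m' y w * symbInvSq α β w ^ p * Φ w) = 0 := by
  rw [contourMean.congr (by norm_num) fun w hw => by
    rw [innerFactor_mul_symbInvSq_pow_eq_smul_projF hα hαβ hsq_sq hsq_pos p m' y
      (re_pos_of_mem_closedBall (Metric.sphere_subset_closedBall hw))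
      (ne_one_of_mem_sphere_one hw)]]
  exact contourMean.eq_zero (by norm_num)
    (((entryDiff_smul_projF hα hαβ hsq_sq hsq_an hsq_pos m' y).mono
      fun w hw => re_pos_of_mem_closedBall hw).mul hΦ)

lemma entryDiff_innerFactor_sphere (hα : 1 < α) (hαβ : α * β = 1)
    (hsq_sq : ∀ z ∉ cuts α β, (sq z) ^ 2 = z * (z + (α : ℂ) ^ 2) * (z + (β : ℂ) ^ 2))
    (hsq_an : DifferentiableOn ℂ sq (cuts α β)ᶜ)
    (hsq_pos : ∀ x : ℝ, 0 < x → 0 < (sq (x : ℂ)).re ∧ (sq (x : ℂ)).im = 0)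
    (p m' : ℕ) (y : ℤ) :
    EntryDiff (innerFactor α β sq p m' y) (Metric.sphere 1 (1 / 2)) :=
  (entryDiff_innerFactor hα hαβ hsq_sq hsq_an hsq_pos p m' y).mono fun _ hw =>
    ⟨re_pos_of_mem_closedBall (Metric.sphere_subset_closedBall hw), ne_one_of_mem_sphere_one hw⟩

variable {p : ℕ} {q : ℕ → ℂ → Matrix (Fin 2) (Fin 2) ℂ}

lemma contourMean_sub_inv_smul_innerFactor_mul (hα : 1 < α) (hαβ : α * β = 1)
    (hsq_sq : ∀ z ∉ cuts α β, (sq z) ^ 2 = z * (z + (α : ℂ) ^ 2) * (z + (β : ℂ) ^ 2))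
    (hsq_an : DifferentiableOn ℂ sq (cuts α β)ᶜ)
    (hsq_pos : ∀ x : ℝ, 0 < x → 0 < (sq (x : ℂ)).re ∧ (sq (x : ℂ)).im = 0)
    (hq : ∀ k, EntryDiff (q k) Set.univ)
    (hqe : ∀ z w, symbInvSq α β z ^ p - symbInvSq α β w ^ p =
      (z - w) • ∑ k ∈ Finset.range (2 * p), z ^ k • q k w)
    (m' : ℕ) (y : ℤ) {z : ℂ} (hz : z ∈ Metric.sphere (0 : ℂ) 3) :
    contourMean 1 (1 / 2)
        (fun w => (z - w)⁻¹ • (innerFactor α β sq p m' y w * symbInvSq α β z ^ p)) =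
      ∑ k ∈ Finset.range (2 * p),
        z ^ k • contourMean 1 (1 / 2) (fun w => innerFactor α β sq p m' y w * q k w) := by
  have hW := entryDiff_innerFactor_sphere hα hαβ hsq_sq hsq_an hsq_pos p m' y
  have hinv : EntryDiff (fun w => (z - w)⁻¹ • (1 : Matrix (Fin 2) (Fin 2) ℂ))
      (Metric.closedBall 1 (1 / 2)) :=
    EntryDiff.smul (f := fun w => (z - w)⁻¹)
      (DifferentiableOn.inv (by fun_prop) fun w hw => sub_ne_zero_of_mem_spheres hz hw)
      (EntryDiff.const 1)
  have hterm : ∀ k, EntryDiff (fun w => z ^ k • (innerFactor α β sq p m' y w * q k w))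
      (Metric.sphere 1 (1 / 2)) := fun k =>
    EntryDiff.smul (f := fun _ => z ^ k) (by fun_prop) (hW.mul ((hq k).mono (Set.subset_univ _)))
  have hM : EntryDiff (fun w => innerFactor α β sq p m' y w * symbInvSq α β w ^ p *
      ((z - w)⁻¹ • (1 : Matrix (Fin 2) (Fin 2) ℂ))) (Metric.sphere 1 (1 / 2)) :=
    (hW.mul (entryDiff_symbInvSq.pow p |>.mono (Set.subset_univ _))).mul
      (hinv.mono Metric.sphere_subset_closedBall)
  have e : ∀ w ∈ Metric.sphere (1 : ℂ) (1 / 2),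
      (z - w)⁻¹ • (innerFactor α β sq p m' y w * symbInvSq α β z ^ p) =
        ∑ k ∈ Finset.range (2 * p), z ^ k • (innerFactor α β sq p m' y w * q k w) +
          innerFactor α β sq p m' y w * symbInvSq α β w ^ p *
            ((z - w)⁻¹ • (1 : Matrix (Fin 2) (Fin 2) ℂ)) := by
    intro w hw
    have h := sub_ne_zero_of_mem_spheres hz (Metric.sphere_subset_closedBall hw)
    rw [sub_eq_iff_eq_add.1 (hqe z w), mul_add, smul_add, mul_smul_comm, smul_smul,
      inv_mul_cancel₀ h, one_smul, Finset.mul_sum, mul_smul_comm, mul_one]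
    simp only [mul_smul_comm]
  rw [contourMean.congr (by norm_num) e,
    contourMean.add (by norm_num) (EntryDiff.sum fun k _ => hterm k) hM,
    contourMean_innerFactor_mul_eq_zero hα hαβ hsq_sq hsq_an hsq_pos p m' y hinv, add_zero,
    contourMean.sum (by norm_num) fun k _ => hterm k]
  simp only [contourMean.smul]

lemma sum_mul_TpowBlock (hαβ : α * β = 1)
    (hqe : ∀ z w, symbInvSq α β z ^ p - symbInvSq α β w ^ p =
      (z - w) • ∑ k ∈ Finset.range (2 * p), z ^ k • q k w)
    {l : ℕ} (hl : l < 2 * p) {w : ℂ} (hw : w ∈ Metric.closedBall (1 : ℂ) (1 / 2)) :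
    ∑ k ∈ Finset.range (2 * p), q k w * TpowBlock α β (2 * (2 * p)) k l =
      w ^ (2 * p - l - 1) • symbSq α β w ^ p - symbInvSq α β w ^ p * contourMean 0 3
        (fun z => (z - w)⁻¹ • (z ^ (-(l : ℤ) - 1) • symbA α β z ^ (2 * (2 * p)))) := by
  have hsub : Metric.sphere (0 : ℂ) 3 ⊆ {z | z ≠ 0 ∧ z ≠ 1} := fun z hz =>
    mem_sphere_zero_three_ne hz
  have hZ : ∀ e : ℤ, EntryDiff (fun z => z ^ e • symbA α β z ^ (2 * (2 * p)))
      (Metric.sphere 0 3) := fun e => (entryDiff_zpow_smul_symbA_pow α β e _).mono hsub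
  have hinv : DifferentiableOn ℂ (fun z => (z - w)⁻¹) (Metric.sphere 0 3) :=
    DifferentiableOn.inv (by fun_prop) fun z hz => sub_ne_zero_of_mem_spheres hz hw
  have hQ : EntryDiff (fun z => z ^ (2 * p - l - 1) • symbSq α β z ^ p) Set.univ :=
    EntryDiff.smul (f := fun z => z ^ (2 * p - l - 1)) (by fun_prop) (entryDiff_symbSq.pow p)
  have e : ∀ z ∈ Metric.sphere (0 : ℂ) 3,
      ∑ k ∈ Finset.range (2 * p), q k w * (z ^ ((k : ℤ) - l - 1) • symbA α β z ^ (2 * (2 * p))) =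
        (z - w)⁻¹ • (z ^ (2 * p - l - 1) • symbSq α β z ^ p) - symbInvSq α β w ^ p *
          ((z - w)⁻¹ • (z ^ (-(l : ℤ) - 1) • symbA α β z ^ (2 * (2 * p)))) := by
    intro z hz
    obtain ⟨h0, h1⟩ := mem_sphere_zero_three_ne hz
    have h := sub_ne_zero_of_mem_spheres hz hw
    have h2 : ∑ k ∈ Finset.range (2 * p), z ^ k • q k w =
        (z - w)⁻¹ • (symbInvSq α β z ^ p - symbInvSq α β w ^ p) := by
      rw [hqe, smul_smul, inv_mul_cancel₀ h, one_smul]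
    have h3 : ∀ k : ℕ, z ^ ((k : ℤ) - l - 1) = z ^ k * z ^ (-(l : ℤ) - 1) := fun k => by
      rw [← zpow_natCast z k, ← zpow_add₀ h0]
      congr 1
      ring
    have h4 : z ^ (2 * p - l - 1) = z ^ (-(l : ℤ) - 1) * z ^ (2 * p) := by
      rw [← zpow_natCast z (2 * p), ← zpow_natCast, ← zpow_add₀ h0]
      congr 1
      omega
    have h5 : ∑ k ∈ Finset.range (2 * p),
        q k w * (z ^ ((k : ℤ) - l - 1) • symbA α β z ^ (2 * (2 * p))) =
        (∑ k ∈ Finset.range (2 * p), z ^ k • q k w) *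
          (z ^ (-(l : ℤ) - 1) • symbA α β z ^ (2 * (2 * p))) := by
      rw [Finset.sum_mul]
      refine Finset.sum_congr rfl fun k _ => ?_
      rw [h3, smul_mul_smul_comm, mul_smul_comm]
    rw [h5, h2, smul_mul_assoc, sub_mul, smul_sub]
    congr 1
    · rw [mul_smul_comm, symbInvSq_pow_mul hαβ h0 h1, smul_smul (z ^ (-(l : ℤ) - 1)), h4]
    · rw [mul_smul_comm (z - w)⁻¹]
  simp only [TpowBlock_eq_contourMean]
  rw [Finset.sum_congr rfl fun k _ => (contourMean.const_mul (by norm_num) (hZ _) (q k w)).symm,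
    ← contourMean.sum (by norm_num) fun k _ => (EntryDiff.const _).mul (hZ _),
    contourMean.congr (by norm_num) e,
    contourMean.sub (by norm_num) (EntryDiff.smul hinv (hQ.mono (Set.subset_univ _)))
      ((EntryDiff.const _).mul (EntryDiff.smul hinv (hZ _))),
    contourMean.sub_inv_smul (hQ.mono (Set.subset_univ _)) (mem_ball_zero_three hw),
    contourMean.const_mul (by norm_num) (EntryDiff.smul hinv (hZ _))]

lemma innerFactor_mul_smul_symbSq_pow (hαβ : α * β = 1) (m' : ℕ) (y : ℤ)
    (hm' : m' ≤ 2 * (2 * p)) {l : ℕ} (hl : l < 2 * p) {w : ℂ} (hw : 0 < w.re) (h1 : w ≠ 1) :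
    innerFactor α β sq p m' y w * (w ^ (2 * p - l - 1) • symbSq α β w ^ p) =
      w ^ (y - l - 1) • (symbA α β w ^ (2 * (2 * p) - m') * projF α β sq w) := by
  have h0 := ne_zero_of_re_pos hw
  have hu := isUnit_det_symbA hαβ h0 h1
  have h4 : w ^ (2 * p - l - 1) = w ^ (-(l : ℤ) - 1) * w ^ (2 * p) := by
    rw [← zpow_natCast w (2 * p), ← zpow_natCast, ← zpow_add₀ h0]
    congr 1
    omega
  have h5 : w ^ (y - l - 1) = w ^ (-(l : ℤ) - 1) * w ^ y := by
    rw [← zpow_add₀ h0]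
    congr 1
    ring
  have hc : projF α β sq w * symbA α β w ^ (2 * (2 * p)) =
      symbA α β w ^ (2 * (2 * p)) * projF α β sq w :=
    (Commute.pow_right (projF_mul_symbA w) _).eq
  rw [h4, mul_smul, ← symbInvSq_pow_mul hαβ h0 h1, mul_smul_comm, ← mul_assoc,
    innerFactor_mul_symbInvSq_pow hαβ p m' y hw h1, smul_mul_assoc, smul_smul, h5, mul_assoc, hc,
    ← mul_assoc, ← zpow_natCast _ (2 * (2 * p)), ← Matrix.zpow_add hu, ← zpow_natCast]
  congr 3
  omega

lemma contourMean_zpow_smul_symbA_pow_mul_projF (hα : 1 < α) (hαβ : α * β = 1)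
    (hsq_sq : ∀ z ∉ cuts α β, (sq z) ^ 2 = z * (z + (α : ℂ) ^ 2) * (z + (β : ℂ) ^ 2))
    (hsq_an : DifferentiableOn ℂ sq (cuts α β)ᶜ)
    (hsq_pos : ∀ x : ℝ, 0 < x → 0 < (sq (x : ℂ)).re ∧ (sq (x : ℂ)).im = 0) (e : ℤ) (n : ℕ) :
    contourMean 1 (1 / 2) (fun w => w ^ e • (symbA α β w ^ n * projF α β sq w)) =
      contourMean 1 (1 / 2) (fun w => w ^ e • symbA α β w ^ n) := by
  have hpos : ∀ w ∈ Metric.closedBall (1 : ℂ) (1 / 2), 0 < w.re := fun w hw =>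
    re_pos_of_mem_closedBall hw
  have hne : Metric.sphere (1 : ℂ) (1 / 2) ⊆ {z | z ≠ 0 ∧ z ≠ 1} := fun w hw =>
    ⟨ne_zero_of_re_pos (hpos w (Metric.sphere_subset_closedBall hw)), ne_one_of_mem_sphere_one hw⟩
  have hΨ : EntryDiff (fun w => (w ^ e * (-(w * (w - 1)) * (eigNum α β sq w)⁻¹) ^ n) •
      (1 - projF α β sq w)) (Metric.closedBall 1 (1 / 2)) := by
    have h := ((differentiableOn_eigNum hsq_an).mono hpos).inv fun w hw =>
      eigNum_ne_zero hα hαβ hsq_sq hsq_pos (hpos w hw)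
    exact EntryDiff.smul
      (f := fun w => w ^ e * (-(w * (w - 1)) * (eigNum α β sq w)⁻¹) ^ n)
      ((differentiableOn_zpow_of_ne (fun w hw => ne_zero_of_re_pos (hpos w hw)) e).mul
        (DifferentiableOn.pow (DifferentiableOn.mul (by fun_prop) h) _))
      ((EntryDiff.const 1).sub ((entryDiff_projF hsq_sq hsq_an).mono hpos))
  have key : ∀ w ∈ Metric.sphere (1 : ℂ) (1 / 2),
      w ^ e • (symbA α β w ^ n * projF α β sq w) = w ^ e • symbA α β w ^ n -
        (w ^ e * (-(w * (w - 1)) * (eigNum α β sq w)⁻¹) ^ n) • (1 - projF α β sq w) := by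
    intro w hw
    rw [mul_smul, ← Matrix.pow_mul_of_mul_eq_smul (symbA_mul_one_sub_projF hα hαβ hsq_sq hsq_pos
      (hpos w (Metric.sphere_subset_closedBall hw)) (ne_one_of_mem_sphere_one hw)), mul_sub,
      smul_sub, mul_one, sub_sub_cancel]
  rw [contourMean.congr (by norm_num) key, contourMean.sub (by norm_num)
    ((entryDiff_zpow_smul_symbA_pow α β e n).mono hne)
    (hΨ.mono Metric.sphere_subset_closedBall), contourMean.eq_zero (by norm_num) hΨ, sub_zero]

lemma sum_contourMean_mul_TpowBlock (hα : 1 < α) (hαβ : α * β = 1)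
    (hsq_sq : ∀ z ∉ cuts α β, (sq z) ^ 2 = z * (z + (α : ℂ) ^ 2) * (z + (β : ℂ) ^ 2))
    (hsq_an : DifferentiableOn ℂ sq (cuts α β)ᶜ)
    (hsq_pos : ∀ x : ℝ, 0 < x → 0 < (sq (x : ℂ)).re ∧ (sq (x : ℂ)).im = 0)
    (hq : ∀ k, EntryDiff (q k) Set.univ)
    (hqe : ∀ z w, symbInvSq α β z ^ p - symbInvSq α β w ^ p =
      (z - w) • ∑ k ∈ Finset.range (2 * p), z ^ k • q k w)
    {m' : ℕ} (hm' : m' ≤ 2 * (2 * p)) {y : ℤ} (hy : (m' : ℤ) ≤ 2 * y) {l : ℕ} (hl : l < 2 * p) :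
    ∑ k ∈ Finset.range (2 * p),
        contourMean 1 (1 / 2) (fun w => innerFactor α β sq p m' y w * q k w) *
          TpowBlock α β (2 * (2 * p)) k l =
      TpowBlock α β (2 * (2 * p) - m') y l := by
  have hW := entryDiff_innerFactor_sphere hα hαβ hsq_sq hsq_an hsq_pos p m' y
  have hWq : ∀ k, EntryDiff (fun w => innerFactor α β sq p m' y w * q k w)
      (Metric.sphere 1 (1 / 2)) := fun k => hW.mul ((hq k).mono (Set.subset_univ _))
  have hS : EntryDiff (fun w => contourMean 0 3
      (fun z => (z - w)⁻¹ • (z ^ (-(l : ℤ) - 1) • symbA α β z ^ (2 * (2 * p)))))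
      (Metric.closedBall 1 (1 / 2)) :=
    (contourMean.entryDiff_sub_inv_smul (R := 3) (by norm_num)
      ((entryDiff_zpow_smul_symbA_pow α β _ _).mono fun z hz =>
        mem_sphere_zero_three_ne hz)).mono fun w hw => mem_ball_zero_three hw
  have hQ : EntryDiff (fun w => w ^ (2 * p - l - 1) • symbSq α β w ^ p)
      (Metric.sphere 1 (1 / 2)) :=
    EntryDiff.smul (f := fun z => z ^ (2 * p - l - 1)) (by fun_prop)
      ((entryDiff_symbSq.pow p).mono (Set.subset_univ _))
  have key : ∀ w ∈ Metric.sphere (1 : ℂ) (1 / 2),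
      ∑ k ∈ Finset.range (2 * p), innerFactor α β sq p m' y w * q k w *
          TpowBlock α β (2 * (2 * p)) k l =
        innerFactor α β sq p m' y w * (w ^ (2 * p - l - 1) • symbSq α β w ^ p) -
          innerFactor α β sq p m' y w * symbInvSq α β w ^ p * contourMean 0 3
            (fun z => (z - w)⁻¹ • (z ^ (-(l : ℤ) - 1) • symbA α β z ^ (2 * (2 * p)))) := by
    intro w hw
    simp only [mul_assoc (innerFactor α β sq p m' y w)]
    rw [← Finset.mul_sum, sum_mul_TpowBlock hαβ hqe hl (Metric.sphere_subset_closedBall hw),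
      mul_sub]
  rw [Finset.sum_congr rfl fun k _ => (contourMean.mul_const (by norm_num) (hWq k) _).symm,
    ← contourMean.sum (by norm_num) fun k _ => (hWq k).mul (EntryDiff.const _),
    contourMean.congr (by norm_num) key,
    contourMean.sub (by norm_num) (hW.mul hQ)
      ((hW.mul ((entryDiff_symbInvSq.pow p).mono (Set.subset_univ _))).mul
        (hS.mono Metric.sphere_subset_closedBall)),
    contourMean_innerFactor_mul_eq_zero hα hαβ hsq_sq hsq_an hsq_pos p m' y hS, sub_zero,
    contourMean.congr (by norm_num) fun w hw => innerFactor_mul_smul_symbSq_pow hαβ m' y hm' hl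
      (re_pos_of_mem_closedBall (Metric.sphere_subset_closedBall hw)) (ne_one_of_mem_sphere_one hw),
    contourMean_zpow_smul_symbA_pow_mul_projF hα hαβ hsq_sq hsq_an hsq_pos,
    contourMean_zpow_smul_symbA_pow hαβ _ _ (by omega), TpowBlock_eq_contourMean]

end InnerIntegral

lemma Finset.sum_range_two_mul {M : Type*} [AddCommMonoid M] (f : ℕ → M) (n : ℕ) :
    ∑ i ∈ Finset.range (2 * n), f i = ∑ k ∈ Finset.range n, (f (2 * k) + f (2 * k + 1)) := by
  induction n with
  | zero => simp
  | succ n ih =>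
    rw [Nat.mul_succ, Finset.sum_range_succ, Finset.sum_range_succ, ih, Finset.sum_range_succ,
      add_assoc]

lemma sum_mul_TpowBlock_apply (α β : ℝ) (V : ℕ → Matrix (Fin 2) (Fin 2) ℂ) (n s : ℕ) (u : ℤ)
    (a b : Fin 2) :
    (∑ k ∈ Finset.range n, V k * TpowBlock α β s k u) a b =
      ∑ i : Fin (2 * n), V ((i : ℕ) / 2) a (Fin.ofNat 2 i) *
        (Tpow α β s ((i : ℕ) : ℤ) (2 * u + (b : ℕ)) : ℂ) := by
  rw [Fin.sum_univ_eq_sum_range (fun i => V (i / 2) a (Fin.ofNat 2 i) *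
    (Tpow α β s (i : ℤ) (2 * u + (b : ℕ)) : ℂ)), Finset.sum_range_two_mul, Matrix.sum_apply]
  refine Finset.sum_congr rfl fun k _ => ?_
  have h1 : (2 * k + 1) / 2 = k := by omega
  have h2 : Fin.ofNat 2 (2 * k) = 0 := Fin.ext (by simp)
  have h3 : Fin.ofNat 2 (2 * k + 1) = 1 := Fin.ext (by simp [Nat.add_mod])
  rw [h1, h2, h3]
  simp [Matrix.mul_apply, TpowBlock]

/-- If `r = v G`, then the double sum `Σ tᵢ (G⁻¹)ⱼᵢ rⱼ` collapses to `Σ vᵢ tᵢ`. -/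
lemma sum_mul_inv_mul_eq {n : ℕ} {G : Matrix (Fin n) (Fin n) ℝ} (hG : IsUnit G.det)
    {r v t : Fin n → ℂ} (hr : ∀ j, ∑ i, v i * (G i j : ℂ) = r j) :
    ∑ i, ∑ j, t i * ((G⁻¹ j i : ℝ) : ℂ) * r j = ∑ i, v i * t i := by
  refine Finset.sum_congr rfl fun i _ => ?_
  have hinv : ∀ k, ∑ j, (G k j : ℂ) * ((G⁻¹ j i : ℝ) : ℂ) = if k = i then 1 else 0 := fun k => by
    have h := congrFun (congrFun (Matrix.mul_nonsing_inv G hG) k) i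
    rw [Matrix.mul_apply, Matrix.one_apply] at h
    have h' := congrArg Complex.ofReal h
    rw [apply_ite Complex.ofReal, Complex.ofReal_one, Complex.ofReal_zero] at h'
    push_cast at h'
    exact h'
  calc ∑ j, t i * ((G⁻¹ j i : ℝ) : ℂ) * r j
      = ∑ j, ∑ k, t i * (v k * ((G k j : ℂ) * ((G⁻¹ j i : ℝ) : ℂ))) := by
        refine Finset.sum_congr rfl fun j _ => ?_
        rw [← hr, Finset.mul_sum]
        refine Finset.sum_congr rfl fun k _ => ?_
        ring
    _ = ∑ k, t i * (v k * ∑ j, (G k j : ℂ) * ((G⁻¹ j i : ℝ) : ℂ)) := by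
        rw [Finset.sum_comm]
        simp only [Finset.mul_sum]
    _ = v i * t i := by simp [hinv, mul_comm]

section Kernel

variable {α β : ℝ} {sq : ℂ → ℂ} {p : ℕ} {q : ℕ → ℂ → Matrix (Fin 2) (Fin 2) ℂ}

lemma sum_gramT_inv_eq (hα : 1 < α) (hαβ : α * β = 1)
    (hsq_sq : ∀ z ∉ cuts α β, (sq z) ^ 2 = z * (z + (α : ℂ) ^ 2) * (z + (β : ℂ) ^ 2))
    (hsq_an : DifferentiableOn ℂ sq (cuts α β)ᶜ)
    (hsq_pos : ∀ x : ℝ, 0 < x → 0 < (sq (x : ℂ)).re ∧ (sq (x : ℂ)).im = 0)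
    (hq : ∀ k, EntryDiff (q k) Set.univ)
    (hqe : ∀ z w, symbInvSq α β z ^ p - symbInvSq α β w ^ p =
      (z - w) • ∑ k ∈ Finset.range (2 * p), z ^ k • q k w)
    {m' : ℕ} (hm' : m' ≤ 2 * (2 * p)) {y : ℤ} (hy : (m' : ℤ) ≤ 2 * y)
    (hG : IsUnit (gramT α β (2 * p)).det) (m : ℕ) (x : ℤ) (a b : Fin 2) :
    ((∑ i : Fin (2 * (2 * p)), ∑ j : Fin (2 * (2 * p)),
      Tpow α β m ((i : ℕ) : ℤ) (2 * x + (b : ℕ)) * (gramT α β (2 * p))⁻¹ j i *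
        Tpow α β (2 * (2 * p) - m') (2 * y + (a : ℕ)) ((j : ℕ) : ℤ) : ℝ) : ℂ) =
      (∑ k ∈ Finset.range (2 * p),
        contourMean 1 (1 / 2) (fun w => innerFactor α β sq p m' y w * q k w) *
          TpowBlock α β m k x) a b := by
  rw [sum_mul_TpowBlock_apply]
  push_cast
  refine sum_mul_inv_mul_eq hG fun j => ?_
  have hj : ((j : ℕ) : ℤ) = 2 * (((j : ℕ) / 2 : ℕ) : ℤ) + ((Fin.ofNat 2 (j : ℕ) : Fin 2) : ℕ) := by
    rw [Fin.val_ofNat]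
    omega
  have h := sum_mul_TpowBlock_apply α β
    (fun k => contourMean 1 (1 / 2) (fun w => innerFactor α β sq p m' y w * q k w)) (2 * p)
    (2 * (2 * p)) ((j : ℕ) / 2 : ℕ) a (Fin.ofNat 2 j)
  rw [← hj, sum_contourMean_mul_TpowBlock hα hαβ hsq_sq hsq_an hsq_pos hq hqe hm' hy
    (by omega)] at h
  simp only [gramT, Matrix.of_apply]
  rw [← h, TpowBlock, Matrix.of_apply, ← hj]

lemma contourMean_contourMean_eq_sum (hα : 1 < α) (hαβ : α * β = 1)
    (hsq_sq : ∀ z ∉ cuts α β, (sq z) ^ 2 = z * (z + (α : ℂ) ^ 2) * (z + (β : ℂ) ^ 2))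
    (hsq_an : DifferentiableOn ℂ sq (cuts α β)ᶜ)
    (hsq_pos : ∀ x : ℝ, 0 < x → 0 < (sq (x : ℂ)).re ∧ (sq (x : ℂ)).im = 0)
    (hq : ∀ k, EntryDiff (q k) Set.univ)
    (hqe : ∀ z w, symbInvSq α β z ^ p - symbInvSq α β w ^ p =
      (z - w) • ∑ k ∈ Finset.range (2 * p), z ^ k • q k w)
    (m m' : ℕ) (x y : ℤ) :
    contourMean 0 3 (fun z => contourMean 1 (1 / 2) (fun w =>
      ((z ^ p * (z - 1) ^ (2 * p)) / (w ^ p * (w - 1) ^ (2 * p)) * w ^ y * z ^ (-x) *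
        (z * (z - w))⁻¹) • (symbA α β w ^ (((2 * p : ℕ) : ℤ) - m') * projF α β sq w *
          symbA α β z ^ ((m : ℤ) - (2 * p : ℕ))))) =
      ∑ k ∈ Finset.range (2 * p),
        contourMean 1 (1 / 2) (fun w => innerFactor α β sq p m' y w * q k w) *
          TpowBlock α β m k x := by
  have hW := entryDiff_innerFactor_sphere hα hαβ hsq_sq hsq_an hsq_pos p m' y
  have hZ : ∀ e : ℤ, EntryDiff (fun z => z ^ e • symbA α β z ^ m) (Metric.sphere 0 3) :=
    fun e => (entryDiff_zpow_smul_symbA_pow α β e _).mono fun z hz => mem_sphere_zero_three_ne hz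
  have key : ∀ z ∈ Metric.sphere (0 : ℂ) 3, contourMean 1 (1 / 2) (fun w =>
      ((z ^ p * (z - 1) ^ (2 * p)) / (w ^ p * (w - 1) ^ (2 * p)) * w ^ y * z ^ (-x) *
        (z * (z - w))⁻¹) • (symbA α β w ^ (((2 * p : ℕ) : ℤ) - m') * projF α β sq w *
          symbA α β z ^ ((m : ℤ) - (2 * p : ℕ)))) = ∑ k ∈ Finset.range (2 * p),
        contourMean 1 (1 / 2) (fun w => innerFactor α β sq p m' y w * q k w) *
          (z ^ ((k : ℤ) - x - 1) • symbA α β z ^ m) := by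
    intro z hz
    obtain ⟨h0, h1⟩ := mem_sphere_zero_three_ne hz
    have hu := isUnit_det_symbA hαβ h0 h1
    have hz1 : z ^ (-x - 1) = z ^ (-x) * z⁻¹ := by rw [zpow_sub_one₀ h0]
    have hA : symbA α β z ^ ((m : ℤ) - (2 * p : ℕ)) =
        symbA α β z ^ (-((2 * p : ℕ) : ℤ)) * symbA α β z ^ m := by
      rw [← zpow_natCast, ← Matrix.zpow_add hu]
      congr 1
      ring
    have e : ∀ w ∈ Metric.sphere (1 : ℂ) (1 / 2),
        ((z ^ p * (z - 1) ^ (2 * p)) / (w ^ p * (w - 1) ^ (2 * p)) * w ^ y * z ^ (-x) *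
          (z * (z - w))⁻¹) • (symbA α β w ^ (((2 * p : ℕ) : ℤ) - m') * projF α β sq w *
            symbA α β z ^ ((m : ℤ) - (2 * p : ℕ))) =
        (z - w)⁻¹ • (innerFactor α β sq p m' y w * symbInvSq α β z ^ p) *
          (z ^ (-x - 1) • symbA α β z ^ m) := by
      intro w hw
      rw [hA, innerFactor, symbInvSq_pow_eq hαβ h0 h1, hz1, mul_inv]
      simp only [smul_mul_assoc, mul_smul_comm, smul_smul, Matrix.mul_assoc]
      congr 1
      ring
    have hd : EntryDiff (fun w => (z - w)⁻¹ • (innerFactor α β sq p m' y w * symbInvSq α β z ^ p))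
        (Metric.sphere 1 (1 / 2)) :=
      EntryDiff.smul (f := fun w => (z - w)⁻¹) (DifferentiableOn.inv (by fun_prop)
        fun w hw => sub_ne_zero_of_mem_spheres hz (Metric.sphere_subset_closedBall hw))
        (hW.mul (EntryDiff.const _))
    rw [contourMean.congr (by norm_num) e, contourMean.mul_const (by norm_num) hd,
      contourMean_sub_inv_smul_innerFactor_mul hα hαβ hsq_sq hsq_an hsq_pos hq hqe m' y hz,
      Finset.sum_mul]
    refine Finset.sum_congr rfl fun k _ => ?_
    rw [smul_mul_smul_comm, mul_smul_comm, ← zpow_natCast z k, ← zpow_add₀ h0]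
    congr 2
    ring
  simp only [TpowBlock_eq_contourMean]
  rw [contourMean.congr (by norm_num) key,
    contourMean.sum (by norm_num) fun k _ => (EntryDiff.const _).mul (hZ _)]
  exact Finset.sum_congr rfl fun k _ => contourMean.const_mul (by norm_num) (hZ _) _

end Kernel

/-- Double contour integral formula for the correlation kernel of the two-periodic
Aztec diamond (Theorem 4.1 / Theorem 1.1 of Duits–Kuijlaars). -/
theorem kernel_double_contour_formula (α β : ℝ) (hα : 1 < α) (hαβ : α * β = 1)
    (sq : ℂ → ℂ)
    (hsq_sq : ∀ z ∉ cuts α β, (sq z) ^ 2 = z * (z + (α : ℂ) ^ 2) * (z + (β : ℂ) ^ 2))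
    (hsq_an : DifferentiableOn ℂ sq (cuts α β)ᶜ)
    (hsq_pos : ∀ x : ℝ, 0 < x → 0 < (sq (x : ℂ)).re ∧ (sq (x : ℂ)).im = 0)
    (N : ℕ) (hN2 : 2 ≤ N) (hNeven : Even N)
    (m m' : ℕ) (hm : 0 < m ∧ m < 2 * N) (hm' : 0 < m' ∧ m' < 2 * N)
    (x y : ℤ) (hy : (m' : ℤ) ≤ 2 * y)
    (hG : IsUnit (gramT α β N).det) :
    (!![((EMker α β N m (2 * x) m' (2 * y) : ℝ) : ℂ),
        ((EMker α β N m (2 * x + 1) m' (2 * y) : ℝ) : ℂ);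
        ((EMker α β N m (2 * x) m' (2 * y + 1) : ℝ) : ℂ),
        ((EMker α β N m (2 * x + 1) m' (2 * y + 1) : ℝ) : ℂ)]) =
      -(if m' < m then
          Matrix.of (fun a b =>
            (2 * (Real.pi : ℂ) * Complex.I)⁻¹ *
              ∮ z in C(0, 3), z ^ (y - x - 1) * (symbA α β z ^ (m - m')) a b)
        else 0) +
      Matrix.of (fun a b =>
        (2 * (Real.pi : ℂ) * Complex.I)⁻¹ * (2 * (Real.pi : ℂ) * Complex.I)⁻¹ *
          ∮ z in C(0, 3),
            (∮ w in C(1, 1 / 2),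
              ((z ^ (N / 2) * (z - 1) ^ N) / (w ^ (N / 2) * (w - 1) ^ N) *
                  w ^ (y : ℤ) * z ^ (-(x : ℤ)) * (z * (z - w))⁻¹) *
                (symbA α β w ^ ((N : ℤ) - (m' : ℤ)) * projF α β sq w *
                  symbA α β z ^ ((m : ℤ) - (N : ℤ))) a b)) := by
  obtain ⟨p, rfl⟩ : ∃ p, N = 2 * p := hNeven.exists_two_nsmul _ |>.imp fun p h => by simpa using h
  obtain ⟨q, hq, hqe⟩ := exists_symbInvSq_pow_sub α β p
  have hp : 2 * p / 2 = p := by omega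
  have entry : ∀ a b : Fin 2,
      ((EMker α β (2 * p) m (2 * x + (b : ℕ)) m' (2 * y + (a : ℕ)) : ℝ) : ℂ) =
        -(if m' < m then
            contourMean 0 3 (fun z => z ^ (y - x - 1) • symbA α β z ^ (m - m')) a b else 0) +
          (∑ k ∈ Finset.range (2 * p),
            contourMean 1 (1 / 2) (fun w => innerFactor α β sq p m' y w * q k w) *
              TpowBlock α β m k x) a b := by
    intro a b
    rw [← sum_gramT_inv_eq hα hαβ hsq_sq hsq_an hsq_pos hq hqe hm'.2.le hy hG, EMker,
      Complex.ofReal_add, Complex.ofReal_neg, ← Tpow_eq_contourMean]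
    split_ifs <;> simp
  have lhs : !![((EMker α β (2 * p) m (2 * x) m' (2 * y) : ℝ) : ℂ),
        ((EMker α β (2 * p) m (2 * x + 1) m' (2 * y) : ℝ) : ℂ);
        ((EMker α β (2 * p) m (2 * x) m' (2 * y + 1) : ℝ) : ℂ),
        ((EMker α β (2 * p) m (2 * x + 1) m' (2 * y + 1) : ℝ) : ℂ)] =
      Matrix.of fun a b : Fin 2 =>
        ((EMker α β (2 * p) m (2 * x + (b : ℕ)) m' (2 * y + (a : ℕ)) : ℝ) : ℂ) := by
    ext a b
    fin_cases a <;> fin_cases b <;> simp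
  rw [lhs]
  ext a b
  rw [Matrix.of_apply, entry, Matrix.add_apply, Matrix.neg_apply,
    ← contourMean_contourMean_eq_sum hα hαβ hsq_sq hsq_an hsq_pos hq hqe, hp]
  congr 1
  · split_ifs <;> rfl
  · simp only [contourMean.apply, Matrix.of_apply, Matrix.smul_apply, smul_eq_mul]
    rw [circleIntegral.integral_const_mul, ← mul_assoc]
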